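/- Let k, m ≥ 2 be integers and n ≥ 1. Let X be an m-colored set of kn points in general position in ℝ². Suppose that X admits a partition into n pairwise disjoint 2-colorful k-tuples (n subsets of size k, each containing points of at least two distinct color classes). Then X spans n pairwise disjoint 2-colorful k-islands; that is, there exist subsets Y₁, …, Yₙ of X, each of size k and each containing points of at least two distinct color classes, with X ∩ conv(Yᵢ) = Yᵢ for every i and the convex hulls conv(Y₁), …, conv(Yₙ) pairwise disjoint. -/

import Mathlib

noncomputable instance (d : ℕ) : DecidableEq (EuclideanSpace ℝ (Fin d)) := Classical.decEq _

/-- A finite point set in `ℝ^d` is in general position if every subset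
of size at most `d + 1` is affinely independent. -/
def GenPos (d : ℕ) (X : Finset (EuclideanSpace ℝ (Fin d))) : Prop :=
  ∀ S : Finset (EuclideanSpace ℝ (Fin d)), S ⊆ X → S.card ≤ d + 1 →
    AffineIndependent ℝ (fun p : S => (p : EuclideanSpace ℝ (Fin d)))


abbrev PL := EuclideanSpace ℝ (Fin 2)

/-- plane dot product of a direction with a point -/
def dotp (u : ℝ × ℝ) (p : ℝ × ℝ) : ℝ := u.1 * p.1 + u.2 * p.2

/-- coordinates -/
def prj (x : PL) : ℝ × ℝ := (x 0, x 1)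

/-- linear functional -/
noncomputable def lfun (u : ℝ × ℝ) : PL →ₗ[ℝ] ℝ where
  toFun x := dotp u (prj x)
  map_add' x y := by simp [dotp, prj]; ring
  map_smul' c x := by simp [dotp, prj]; ring

lemma lfun_apply (u : ℝ × ℝ) (x : PL) : lfun u x = dotp u (prj x) := rfl

lemma GenPos.mono {X A : Finset PL} (h : GenPos 2 X) (hA : A ⊆ X) : GenPos 2 A :=
  fun S hS hc => h S (hS.trans hA) hc

lemma genpos_line {X : Finset PL} (h : GenPos 2 X) {u : ℝ × ℝ} (hu : u ≠ 0) {S : Finset PL}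
    (hS : S ⊆ X) (c : ℝ) (hc : ∀ x ∈ S, lfun u x = c) : S.card ≤ 2 := by
  by_contra hlt
  push Not at hlt
  obtain ⟨T, hTS, hT3⟩ := Finset.exists_subset_card_eq (show 3 ≤ S.card by omega)
  have hind := h T (hTS.trans hS) (by omega)
  have htop : affineSpan ℝ (Set.range (fun p : T => (p : PL))) = ⊤ := by
    rw [hind.affineSpan_eq_top_iff_card_eq_finrank_add_one]
    simp [hT3]
  have hv : vectorSpan ℝ (Set.range (fun p : T => (p : PL))) = ⊤ := by
    rw [← direction_affineSpan, htop, AffineSubspace.direction_top]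
  have hle : vectorSpan ℝ (Set.range (fun p : T => (p : PL))) ≤ LinearMap.ker (lfun u) := by
    rw [vectorSpan, Submodule.span_le]
    rintro x ⟨a, ⟨a', rfl⟩, b, ⟨b', rfl⟩, rfl⟩
    simp only [SetLike.mem_coe, LinearMap.mem_ker, vsub_eq_sub, map_sub]
    rw [hc _ (hTS a'.2), hc _ (hTS b'.2), sub_self]
  rw [hv] at hle
  have := hle (show (!₂[u.1, u.2] : PL) ∈ ⊤ from trivial)
  rw [LinearMap.mem_ker, lfun_apply] at this
  simp [dotp, prj] at this
  apply hu
  ext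
  · simp; nlinarith
  · simp; nlinarith

lemma face_lemma (l : PL →ₗ[ℝ] ℝ) (A : Finset PL) (z : PL) (hz : z ∈ convexHull ℝ (A : Set PL))
    (hl : ∀ a ∈ A, l a ≤ l z) : z ∈ convexHull ℝ ((A.filter (fun a => l a = l z) : Finset PL) : Set PL) := by
  rw [Finset.mem_convexHull'] at hz ⊢
  obtain ⟨w, hw0, hw1, hwz⟩ := hz
  have hsum : ∑ a ∈ A, w a * (l z - l a) = 0 := by
    have : l z = ∑ a ∈ A, w a * l a := by
      conv_lhs => rw [← hwz]
      simp [map_sum]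
    simp only [mul_sub, Finset.sum_sub_distrib, ← Finset.sum_mul, hw1]
    linarith
  rw [Finset.sum_eq_zero_iff_of_nonneg (fun a ha => mul_nonneg (hw0 a ha) (by linarith [hl a ha]))] at hsum
  have h0 : ∀ a ∈ A, ¬ (l a = l z) → w a = 0 := by
    intro a ha hne
    rcases mul_eq_zero.mp (hsum a ha) with h | h
    · exact h
    · exact absurd (by linarith) hne
  refine ⟨w, fun a ha => hw0 a (Finset.mem_filter.mp ha).1, ?_, ?_⟩
  · rw [← hw1]
    apply Finset.sum_subset (Finset.filter_subset _ _)
    intro a ha hn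
    exact h0 a ha (fun h => hn (Finset.mem_filter.mpr ⟨ha, h⟩))
  · rw [← hwz]
    apply Finset.sum_subset (Finset.filter_subset _ _)
    intro a ha hn
    rw [h0 a ha (fun h => hn (Finset.mem_filter.mpr ⟨ha, hwz ▸ h⟩)), zero_smul]

lemma hull_le (l : PL →ₗ[ℝ] ℝ) (A : Set PL) (c : ℝ) (h : ∀ a ∈ A, l a ≤ c) (z : PL)
    (hz : z ∈ convexHull ℝ A) : l z ≤ c := by
  have : convexHull ℝ A ⊆ {x | l x ≤ c} :=
    convexHull_min h (convex_halfSpace_le l.isLinear c)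
  exact this hz

lemma sep_disjoint {X : Finset PL} (h : GenPos 2 X) {u : ℝ × ℝ} (hu : u ≠ 0) {A B : Finset PL}
    (hA : A ⊆ X) (hB : B ⊆ X) (hAB : Disjoint A B) (hsep : ∀ a ∈ A, ∀ b ∈ B, lfun u a ≤ lfun u b) :
    Disjoint (convexHull ℝ (A : Set PL)) (convexHull ℝ (B : Set PL)) := by
  rw [Set.disjoint_left]
  intro z hzA hzB
  have h1 : ∀ b ∈ B, lfun u z ≤ lfun u b := fun b hb =>
    hull_le _ _ _ (fun a ha => hsep a ha b hb) z hzA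
  have h2 : ∀ a ∈ A, lfun u a ≤ lfun u z := by
    intro a ha
    have := hull_le (-lfun u) (B : Set PL) (- lfun u a) (fun b hb => by
      simpa using hsep a ha b hb) z hzB
    simpa using this
  have hA' := face_lemma (lfun u) A z hzA h2
  have hB' := face_lemma (-lfun u) B z hzB (fun b hb => by simpa using h1 b hb)
  set A1 := A.filter (fun a => lfun u a = lfun u z)
  set B1 := B.filter (fun a => (-lfun u) a = (-lfun u) z)
  have hd : Disjoint A1 B1 := Finset.disjoint_filter_filter hAB
  have hc : (A1 ∪ B1).card ≤ 2 := by
    apply genpos_line h hu (c := lfun u z)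
    · exact Finset.union_subset ((Finset.filter_subset _ _).trans hA) ((Finset.filter_subset _ _).trans hB)
    · intro x hx
      rcases Finset.mem_union.mp hx with hx | hx
      · exact (Finset.mem_filter.mp hx).2
      · have := (Finset.mem_filter.mp hx).2
        simpa using this
  rw [Finset.card_union_of_disjoint hd] at hc
  have nA : A1.Nonempty := by
    have := convexHull_nonempty_iff.mp ⟨z, hA'⟩
    simpa using this
  have nB : B1.Nonempty := by
    have := convexHull_nonempty_iff.mp ⟨z, hB'⟩
    simpa using this
  have cA := nA.card_pos
  have cB := nB.card_pos
  obtain ⟨p, hp⟩ := Finset.card_eq_one.mp (show A1.card = 1 by omega)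
  obtain ⟨q, hq⟩ := Finset.card_eq_one.mp (show B1.card = 1 by omega)
  rw [hp] at hA' hd
  rw [hq] at hB' hd
  simp at hA' hB' hd
  exact hd (hA'.symm.trans hB')

/-- `A` is a weak initial segment of `X` in direction `u`. -/
def Pre (X A : Finset PL) (u : ℝ × ℝ) : Prop :=
  A ⊆ X ∧ ∀ a ∈ A, ∀ b ∈ X \ A, lfun u a ≤ lfun u b

lemma exists_pre (X : Finset PL) (u : ℝ × ℝ) (j : ℕ) (hj : j ≤ X.card) :
    ∃ A, Pre X A u ∧ A.card = j := by
  induction j with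
  | zero => exact ⟨∅, ⟨by simp, by simp⟩, rfl⟩
  | succ j ih =>
    obtain ⟨A, hA, hc⟩ := ih (by omega)
    have hne : (X \ A).Nonempty := by
      rw [← Finset.card_pos, Finset.card_sdiff_of_subset hA.1]; omega
    obtain ⟨y, hy, hmin⟩ := Finset.exists_min_image (X \ A) (lfun u) hne
    rw [Finset.mem_sdiff] at hy
    refine ⟨insert y A, ⟨?_, ?_⟩, ?_⟩
    · intro x hx
      rcases Finset.mem_insert.mp hx with rfl | hx
      · exact hy.1
      · exact hA.1 hx
    · intro a ha b hb
      have hb' : b ∈ X \ A := by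
        simp only [Finset.mem_sdiff, Finset.mem_insert] at hb ⊢
        tauto
      rcases Finset.mem_insert.mp ha with rfl | ha
      · exact hmin b hb'
      · exact hA.2 a ha b hb'
    · rw [Finset.card_insert_of_notMem hy.2, hc]

lemma isClosed_pre (X A : Finset PL) : IsClosed {u : ℝ × ℝ | Pre X A u} := by
  have : {u : ℝ × ℝ | Pre X A u} = {u | A ⊆ X} ∩ ⋂ a ∈ A, ⋂ b ∈ X \ A, {u | lfun u a ≤ lfun u b} := by
    ext u; simp only [Pre, Set.mem_ofPred_eq, Set.mem_inter_iff, Set.mem_iInter]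
  rw [this]
  refine IsClosed.inter isClosed_const ?_
  refine isClosed_biInter fun a _ => isClosed_biInter fun b _ => ?_
  refine isClosed_le ?_ ?_ <;> · simp only [lfun_apply, dotp]; fun_prop

lemma pre_diff {X A B : Finset PL} (h : GenPos 2 X) {u : ℝ × ℝ} (hu : u ≠ 0)
    (hA : Pre X A u) (hB : Pre X B u) (hc : A.card = B.card) : (B \ A).card ≤ 1 := by
  have hcc : (A \ B).card = (B \ A).card := Finset.card_sdiff_comm hc
  rcases (B \ A).eq_empty_or_nonempty with he | ⟨y, hy⟩
  · simp [he]
  have hne : (A \ B).Nonempty := by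
    rw [← Finset.card_pos, hcc, Finset.card_pos]; exact ⟨y, hy⟩
  obtain ⟨x, hx⟩ := hne
  have key : ∀ a ∈ A \ B, ∀ b ∈ B \ A, lfun u a = lfun u b := by
    intro a ha b hb
    rw [Finset.mem_sdiff] at ha hb
    apply le_antisymm
    · exact hA.2 a ha.1 b (Finset.mem_sdiff.mpr ⟨hB.1 hb.1, hb.2⟩)
    · exact hB.2 b hb.1 a (Finset.mem_sdiff.mpr ⟨hA.1 ha.1, ha.2⟩)
  have := genpos_line h hu (S := (A \ B) ∪ (B \ A))
    (Finset.union_subset (Finset.sdiff_subset.trans hA.1) (Finset.sdiff_subset.trans hB.1)) (lfun u x) (by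
      intro z hz
      rcases Finset.mem_union.mp hz with hz | hz
      · rw [key z hz y hy, key x hx y hy]
      · exact (key x hx z hz).symm)
  rw [Finset.card_union_of_disjoint (by
    rw [Finset.disjoint_left]; intro z hz hz'
    simp at hz hz'; tauto)] at this
  omega

lemma pre_ivt {X R : Finset PL} (h : GenPos 2 X) (j c : ℕ) {u u' : ℝ × ℝ} (hu : u ≠ 0) (hu' : u' ≠ 0)
    {A A' : Finset PL} (hA : Pre X A u) (hA' : Pre X A' u') (hj : A.card = j) (hj' : A'.card = j)
    (hc : (A ∩ R).card ≤ c) (hc' : c < (A' ∩ R).card) :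
    ∃ v : ℝ × ℝ, v ≠ 0 ∧ ∃ B, Pre X B v ∧ B.card = j ∧ (B ∩ R).card = c + 1 := by
  classical
  have hconn : IsPreconnected ({0}ᶜ : Set (ℝ × ℝ)) :=
    (isConnected_compl_singleton_of_one_lt_rank (by simp [← Module.finrank_eq_rank]) 0).isPreconnected
  rw [isPreconnected_closed_iff] at hconn
  have hjX : j ≤ X.card := hj ▸ Finset.card_le_card hA.1
  have clo : ∀ Q : Finset PL → Prop, IsClosed {w : ℝ × ℝ | ∃ B, Pre X B w ∧ B.card = j ∧ Q B} := by
    intro Q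
    have : {w : ℝ × ℝ | ∃ B, Pre X B w ∧ B.card = j ∧ Q B} =
        ⋃ B ∈ X.powerset.filter (fun B => B.card = j ∧ Q B), {w | Pre X B w} := by
      ext w
      simp only [Set.mem_ofPred_eq, Finset.mem_filter, Finset.mem_powerset, Set.mem_iUnion, exists_prop]
      constructor
      · rintro ⟨B, h1, h2, h3⟩; exact ⟨B, ⟨h1.1, h2, h3⟩, h1⟩
      · rintro ⟨B, ⟨h1, h2, h3⟩, h4⟩; exact ⟨B, h4, h2, h3⟩
    rw [this]
    exact isClosed_biUnion_finset fun B _ => isClosed_pre X B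
  obtain ⟨v, hv, ⟨B, hB, hBj, hBc⟩, ⟨B', hB', hBj', hBc'⟩⟩ := hconn _ _ (clo fun B => (B ∩ R).card ≤ c)
    (clo fun B => c < (B ∩ R).card) (by
      intro w _
      obtain ⟨B, hB, hBj⟩ := exists_pre X w j hjX
      rcases le_or_gt (B ∩ R).card c with h | h
      · exact Or.inl ⟨B, hB, hBj, h⟩
      · exact Or.inr ⟨B, hB, hBj, h⟩) ⟨u, hu, A, hA, hj, hc⟩ ⟨u', hu', A', hA', hj', hc'⟩
  refine ⟨v, hv, B', hB', hBj', ?_⟩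
  have hd := pre_diff h hv hB hB' (hBj.trans hBj'.symm)
  have : (B' ∩ R).card ≤ (B ∩ R).card + (B' \ B).card := by
    refine le_trans (Finset.card_le_card ?_) (Finset.card_union_le _ _)
    intro z hz
    simp only [Finset.mem_inter, Finset.mem_union, Finset.mem_sdiff] at hz ⊢
    tauto
  omega

open Classical in
/-- parity of the crossing of the segment `PQ` with the ray `d = 0, e > 0` -/
noncomputable def crossing (P Q : ℝ × ℝ) : ZMod 2 :=
  if (0 ≤ P.1 ∧ Q.1 < 0 ∧ 0 < P.1 * Q.2 - Q.1 * P.2) ∨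
    (P.1 < 0 ∧ 0 ≤ Q.1 ∧ 0 < Q.1 * P.2 - P.1 * Q.2) then 1 else 0

open Classical in
noncomputable def sgp (P : ℝ × ℝ) : ZMod 2 := if 0 ≤ P.1 then 1 else 0

lemma zmod2_add_self (a : ZMod 2) : a + a = 0 := CharTwo.add_self_eq_zero a

lemma crossing_aux {P Q : ℝ × ℝ} {α β : ℝ} (hP : 0 < α * P.1 + β * P.2) (hQ : 0 < α * Q.1 + β * Q.2)
    (h1 : 0 ≤ P.1) (h2 : Q.1 < 0) : 0 < β * (P.1 * Q.2 - Q.1 * P.2) := by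
  have e1 : 0 ≤ P.1 * (α * Q.1 + β * Q.2) := mul_nonneg h1 hQ.le
  have e2 : 0 < -Q.1 * (α * P.1 + β * P.2) := mul_pos (by linarith) hP
  nlinarith

lemma crossing_of_pos {P Q : ℝ × ℝ} {α β : ℝ} (hP : 0 < α * P.1 + β * P.2)
    (hQ : 0 < α * Q.1 + β * Q.2) (hβ : 0 < β) : crossing P Q = sgp P + sgp Q := by
  unfold crossing sgp
  rcases le_or_gt 0 P.1 with h1 | h1 <;> rcases le_or_gt 0 Q.1 with h2 | h2
  · simp [h1, h2, not_lt.mpr h1, not_lt.mpr h2]; rfl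
  · have := pos_of_mul_pos_right (crossing_aux hP hQ h1 h2) hβ.le
    rw [if_pos (Or.inl ⟨h1, h2, this⟩), if_pos h1, if_neg (not_le.mpr h2), add_zero]
  · have := pos_of_mul_pos_right (crossing_aux hQ hP h2 h1) hβ.le
    rw [if_pos (Or.inr ⟨h1, h2, this⟩), if_pos h2, if_neg (not_le.mpr h1), zero_add]
  · simp [not_le.mpr h1, not_le.mpr h2]

lemma crossing_of_nonpos {P Q : ℝ × ℝ} {α β : ℝ} (hP : 0 < α * P.1 + β * P.2)
    (hQ : 0 < α * Q.1 + β * Q.2) (hβ : β ≤ 0) : crossing P Q = 0 := by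
  unfold crossing
  rw [if_neg]
  rintro (⟨h1, h2, h3⟩ | ⟨h1, h2, h3⟩)
  · have := crossing_aux hP hQ h1 h2
    nlinarith
  · have := crossing_aux hQ hP h2 h1
    nlinarith

lemma cell_even {P Q S T : ℝ × ℝ} {α β : ℝ} (hP : 0 < α * P.1 + β * P.2)
    (hQ : 0 < α * Q.1 + β * Q.2) (hS : 0 < α * S.1 + β * S.2) (hT : 0 < α * T.1 + β * T.2) :
    crossing S T = crossing P Q + crossing P S + crossing Q T := by
  rcases lt_or_ge 0 β with h | h
  · rw [crossing_of_pos hS hT h, crossing_of_pos hP hQ h, crossing_of_pos hP hS h,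
      crossing_of_pos hQ hT h]
    have h1 := zmod2_add_self (sgp P)
    have h2 := zmod2_add_self (sgp Q)
    linear_combination - h1 - h2
  · rw [crossing_of_nonpos hS hT h, crossing_of_nonpos hP hQ h, crossing_of_nonpos hP hS h,
      crossing_of_nonpos hQ hT h]
    simp

lemma telescoping (s : ℕ → ZMod 2) (M : ℕ) :
    ∑ i ∈ Finset.range M, (s i + s (i + 1)) = s 0 + s M := by
  induction M with
  | zero => simp [zmod2_add_self]
  | succ M ih =>
    rw [Finset.sum_range_succ, ih]
    have h1 := zmod2_add_self (s M)
    linear_combination h1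

lemma grid_lemma (M : ℕ) (G : ℕ → ℕ → ℝ × ℝ)
    (hcell : ∀ i < M, ∀ j < M, ∃ α β : ℝ, ∀ a ≤ 1, ∀ b ≤ 1,
      0 < α * (G (i + a) (j + b)).1 + β * (G (i + a) (j + b)).2)
    (hleft : ∀ j ≤ M, 0 < (G 0 j).2) (hright : ∀ j ≤ M, 0 < (G M j).2)
    (htop : ∀ i ≤ M, 0 < (G i M).2)
    (hbot : ∀ i < M, crossing (G i 0) (G (i + 1) 0) = 0)
    (h0 : 0 ≤ (G 0 0).1) (hM : (G M 0).1 < 0) : False := by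
  have row : ∀ j < M, ∀ m ≤ M, ∑ i ∈ Finset.range m, crossing (G i (j + 1)) (G (i + 1) (j + 1)) =
      ∑ i ∈ Finset.range m, crossing (G i j) (G (i + 1) j) + crossing (G 0 j) (G 0 (j + 1)) +
        crossing (G m j) (G m (j + 1)) := by
    intro j hj m hm
    induction m with
    | zero => simp [zmod2_add_self]
    | succ m ih =>
      rw [Finset.sum_range_succ, Finset.sum_range_succ, ih (by omega)]
      obtain ⟨α, β, h⟩ := hcell m (by omega) j hj
      have := cell_even (h 0 (by omega) 0 (by omega)) (h 1 (by omega) 0 (by omega))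
        (h 0 (by omega) 1 (by omega)) (h 1 (by omega) 1 (by omega))
      simp only [add_zero] at this
      rw [this]
      have h1 := zmod2_add_self (crossing (G m j) (G m (j + 1)))
      linear_combination h1
  have e1 : ∀ P Q : ℝ × ℝ, 0 < P.2 → 0 < Q.2 → crossing P Q = sgp P + sgp Q := fun P Q hP hQ =>
    crossing_of_pos (α := 0) (β := 1) (by simpa using hP) (by simpa using hQ) one_pos
  have all : ∀ j ≤ M, ∑ i ∈ Finset.range M, crossing (G i j) (G (i + 1) j) =
      sgp (G 0 0) + sgp (G 0 j) + sgp (G M 0) + sgp (G M j) := by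
    intro j hj
    induction j with
    | zero =>
      rw [Finset.sum_eq_zero (fun i hi => hbot i (Finset.mem_range.mp hi))]
      have h1 := zmod2_add_self (sgp (G 0 0))
      have h2 := zmod2_add_self (sgp (G M 0))
      linear_combination - h1 - h2
    | succ j ih =>
      rw [row j (by omega) M le_rfl, ih (by omega), e1 _ _ (hleft j (by omega)) (hleft _ hj),
        e1 _ _ (hright j (by omega)) (hright _ hj)]
      have h1 := zmod2_add_self (sgp (G 0 j))
      have h2 := zmod2_add_self (sgp (G M j))
      linear_combination h1 + h2
  have top := all M le_rfl
  rw [Finset.sum_congr rfl (fun i hi => e1 _ _ (htop i (by have := Finset.mem_range.mp hi; omega))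
    (htop (i + 1) (by have := Finset.mem_range.mp hi; omega))), telescoping (fun i => sgp (G i M))] at top
  have h3 : sgp (G 0 0) = 1 := by simp [sgp, h0]
  have h4 : sgp (G M 0) = 0 := by simp [sgp, hM]
  rw [h3, h4] at top
  have : (1 : ZMod 2) = 0 := by linear_combination - top
  exact absurd this (by decide)

lemma birkhoff_round {ι : Type*} [Fintype ι] [DecidableEq ι] (col : ι → Bool) (z : ι → Fin 3 → ℝ)
    (h0 : ι → Fin 3) (hz : ∀ x j, 0 ≤ z x j) (hrow : ∀ x, ∑ j, z x j = 1)
    (hcol : ∀ b j, ∑ x with col x = b, z x j =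
      ((Finset.univ.filter (fun x => col x = b ∧ h0 x = j)).card : ℝ))
    (c : ι → Fin 3 → ℝ) :
    ∃ f : ι → Fin 3, (∀ b j, (Finset.univ.filter (fun x => col x = b ∧ f x = j)).card =
      (Finset.univ.filter (fun x => col x = b ∧ h0 x = j)).card) ∧
      ∑ x, ∑ j, z x j * c x j ≤ ∑ x, c x (f x) := by
  classical
  set cnt : Bool → Fin 3 → ℕ := fun b j => (Finset.univ.filter (fun x => col x = b ∧ h0 x = j)).card
    with hcnt
  let M : Matrix ι ι ℝ := fun x y => if col y = col x then z x (h0 y) / cnt (col x) (h0 y) else 0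
  have hz0 : ∀ x j, cnt (col x) j = 0 → z x j = 0 := by
    intro x j h
    have := hcol (col x) j
    change _ = ((cnt (col x) j : ℕ) : ℝ) at this
    rw [h, Nat.cast_zero, Finset.sum_eq_zero_iff_of_nonneg (fun _ _ => hz _ _)] at this
    exact this x (by simp)
  have hM : ∀ x (φ : Fin 3 → ℝ), ∑ y, M x y * φ (h0 y) = ∑ j, z x j * φ j := by
    intro x φ
    rw [← Finset.sum_fiberwise Finset.univ h0]
    refine Finset.sum_congr rfl fun j _ => ?_
    have : ∀ y ∈ Finset.univ.filter (fun y => h0 y = j), M x y * φ (h0 y) =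
        if col y = col x then z x j / cnt (col x) j * φ j else 0 := by
      intro y hy
      simp only [Finset.mem_filter, Finset.mem_univ, true_and] at hy
      simp only [M, hy]
      split_ifs <;> simp
    rw [Finset.sum_congr rfl this, ← Finset.sum_filter, Finset.sum_const, Finset.filter_filter]
    have hc : (Finset.univ.filter (fun y => h0 y = j ∧ col y = col x)).card = cnt (col x) j := by
      simp only [hcnt, and_comm]
    rw [hc, nsmul_eq_mul]
    by_cases h : cnt (col x) j = 0
    · rw [hz0 x j h]; simp
    · have : (cnt (col x) j : ℝ) ≠ 0 := by exact_mod_cast h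
      field_simp
  have hds : M ∈ doublyStochastic ℝ ι := by
    rw [mem_doublyStochastic_iff_sum]
    refine ⟨?_, ?_, ?_⟩
    · intro x y
      simp only [M]
      split_ifs
      · exact div_nonneg (hz _ _) (Nat.cast_nonneg _)
      · exact le_rfl
    · intro x
      have := hM x (fun _ => 1)
      simpa [hrow] using this
    · intro y
      have h1 : ∑ x, M x y = ∑ x with col x = col y, z x (h0 y) / cnt (col y) (h0 y) := by
        rw [Finset.sum_filter]
        refine Finset.sum_congr rfl fun x _ => ?_
        simp only [M]
        by_cases h : col x = col y
        · simp [h]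
        · rw [if_neg h, if_neg (fun h' => h h'.symm)]
      rw [h1, ← Finset.sum_div, hcol]
      apply div_self
      have : 0 < cnt (col y) (h0 y) := Finset.card_pos.mpr ⟨y, by simp⟩
      exact_mod_cast this.ne'
  obtain ⟨w, hw0, hw1, hwM⟩ := exists_eq_sum_perm_of_mem_doublyStochastic hds
  have hMxy : ∀ x y, M x y = ∑ σ, w σ * (if σ x = y then 1 else 0) := by
    intro x y
    rw [← hwM]
    simp [Matrix.sum_apply, Equiv.toPEquiv_apply, PEquiv.toMatrix_apply]
  have hcost : ∑ σ, w σ * ∑ x, c x (h0 (σ x)) = ∑ x, ∑ j, z x j * c x j := by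
    have : ∀ x, ∑ j, z x j * c x j = ∑ σ, w σ * c x (h0 (σ x)) := by
      intro x
      rw [← hM x (c x)]
      simp only [hMxy, Finset.sum_mul]
      rw [Finset.sum_comm]
      refine Finset.sum_congr rfl fun σ _ => ?_
      simp
    simp only [this, Finset.mul_sum]
    rw [Finset.sum_comm]
  have hpres : ∀ σ, 0 < w σ → ∀ x, col (σ x) = col x := by
    intro σ hσ x
    by_contra hne
    have h1 : M x (σ x) = 0 := by simp [M, hne]
    rw [hMxy, Finset.sum_eq_zero_iff_of_nonneg] at h1
    · have := h1 σ (Finset.mem_univ _)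
      simp at this
      linarith
    · intro τ _
      refine mul_nonneg (hw0 _) ?_
      split_ifs <;> norm_num
  obtain ⟨σ, hσ, hσc⟩ : ∃ σ, 0 < w σ ∧ ∑ x, ∑ j, z x j * c x j ≤ ∑ x, c x (h0 (σ x)) := by
    by_contra hcon
    push Not at hcon
    set K := ∑ x, ∑ j, z x j * c x j
    have hK : ∑ σ, w σ * K = K := by rw [← Finset.sum_mul, hw1, one_mul]
    have hlt : ∑ σ, w σ * ∑ x, c x (h0 (σ x)) < ∑ σ, w σ * K := by
      apply Finset.sum_lt_sum
      · intro σ _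
        rcases (hw0 σ).eq_or_lt with h | h
        · rw [← h]; simp
        · exact mul_le_mul_of_nonneg_left (hcon σ h).le h.le
      · obtain ⟨σ, _, hσ⟩ : ∃ σ ∈ Finset.univ, 0 < w σ := by
          apply Finset.exists_lt_of_sum_lt (f := fun _ => (0:ℝ))
          rw [hw1]; simp
        exact ⟨σ, Finset.mem_univ _, mul_lt_mul_of_pos_left (hcon σ hσ) hσ⟩
    rw [hcost, hK] at hlt
    exact lt_irrefl _ hlt
  refine ⟨fun x => h0 (σ x), fun b j => ?_, hσc⟩
  refine Finset.card_equiv σ fun x => ?_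
  simp [hpres σ hσ]

set_option linter.unusedSectionVars false
section threecut
variable {ι : Type*} [Fintype ι] [DecidableEq ι]

def tcost (p : ι → ℝ × ℝ) (v : Fin 3 → ℝ × ℝ) (f : ι → Fin 3) : ℝ := ∑ x, dotp (v (f x)) (p x)

def Feas (N : Fin 3 → ℕ) (f : ι → Fin 3) : Prop :=
  ∀ j, (Finset.univ.filter (fun x => f x = j)).card = N j

def IsOpt (p : ι → ℝ × ℝ) (N : Fin 3 → ℕ) (v : Fin 3 → ℝ × ℝ) (f : ι → Fin 3) : Prop :=
  Feas N f ∧ ∀ f', Feas N f' → tcost p v f' ≤ tcost p v f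

/-- number of coloured points in class `j` -/
def redc (col : ι → Bool) (f : ι → Fin 3) (j : Fin 3) : ℕ :=
  (Finset.univ.filter (fun x => col x = true ∧ f x = j)).card

lemma isOpt_exists (p : ι → ℝ × ℝ) (N : Fin 3 → ℕ) (v : Fin 3 → ℝ × ℝ) (f0 : ι → Fin 3)
    (h0 : Feas N f0) : ∃ f, IsOpt p N v f := by
  classical
  obtain ⟨f, hf, hmax⟩ := Finset.exists_max_image (Finset.univ.filter (fun f : ι → Fin 3 => Feas N f))
    (tcost p v) ⟨f0, by simp [h0]⟩
  exact ⟨f, by simpa using hf, fun f' hf' => hmax f' (by simpa using hf')⟩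

lemma opt_swap {p : ι → ℝ × ℝ} {N : Fin 3 → ℕ} {v : Fin 3 → ℝ × ℝ} {f : ι → Fin 3}
    (h : IsOpt p N v f) (a b : ι) :
    dotp (v (f b)) (p a) + dotp (v (f a)) (p b) ≤ dotp (v (f a)) (p a) + dotp (v (f b)) (p b) := by
  by_cases hab : a = b
  · subst hab; exact le_rfl
  have hf : Feas N (fun x => f (Equiv.swap a b x)) := by
    intro j
    rw [← h.1 j]
    exact Finset.card_equiv (Equiv.swap a b) fun x => by simp
  have h2 := h.2 _ hf
  have h3 : tcost p v (fun x => f (Equiv.swap a b x)) - tcost p v f =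
      (dotp (v (f b)) (p a) - dotp (v (f a)) (p a)) + (dotp (v (f a)) (p b) - dotp (v (f b)) (p b)) := by
    unfold tcost
    rw [← Finset.sum_sub_distrib, Fintype.sum_eq_add a b hab]
    · simp
    · rintro x ⟨h1, h2⟩
      beta_reduce
      rw [Equiv.swap_apply_of_ne_of_ne h1 h2, sub_self]
  linarith

lemma opt_pre {p : ι → ℝ × ℝ} {N : Fin 3 → ℕ} {v : Fin 3 → ℝ × ℝ} {f : ι → Fin 3}
    (h : IsOpt p N v f) (j : Fin 3) (u : ℝ × ℝ)
    (hv : ∀ j', j' ≠ j → ∃ c : ℝ, 0 < c ∧ (v j').1 - (v j).1 = c * u.1 ∧ (v j').2 - (v j).2 = c * u.2)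
    (a b : ι) (ha : f a = j) (hb : f b ≠ j) : dotp u (p a) ≤ dotp u (p b) := by
  obtain ⟨c, hc, h1, h2⟩ := hv _ hb
  have := opt_swap h a b
  rw [ha] at this
  have h3 : 0 ≤ c * (dotp u (p b) - dotp u (p a)) := by
    unfold dotp at *
    have e1 : (v (f b)).1 = (v j).1 + c * u.1 := by linarith
    have e2 : (v (f b)).2 = (v j).2 + c * u.2 := by linarith
    rw [e1, e2] at this
    linarith
  have := nonneg_of_mul_nonneg_right h3 hc
  linarith

lemma exists_fib (S : Finset ι) (n : Fin 3 → ℕ) (h : S.card = ∑ j, n j) :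
    ∃ f : ι → Fin 3, ∀ j, (S.filter (fun x => f x = j)).card = n j := by
  rw [Fin.sum_univ_three] at h
  obtain ⟨A, hA, hAc⟩ := Finset.exists_subset_card_eq (show n 0 ≤ S.card by omega)
  have hSA : (S \ A).card = n 1 + n 2 := by rw [Finset.card_sdiff_of_subset hA]; omega
  obtain ⟨B, hB, hBc⟩ := Finset.exists_subset_card_eq (show n 1 ≤ (S \ A).card by omega)
  have hC : ((S \ A) \ B).card = n 2 := by rw [Finset.card_sdiff_of_subset hB]; omega
  refine ⟨fun x => if x ∈ A then 0 else if x ∈ B then 1 else 2, ?_⟩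
  have hB' : ∀ x ∈ B, x ∈ S ∧ x ∉ A := fun x hx => by simpa using hB hx
  have hA' : ∀ x ∈ A, x ∈ S := fun x hx => hA hx
  intro j
  fin_cases j
  · simp only [Fin.zero_eta]
    rw [← hAc]; congr 1; ext x; simp only [Finset.mem_filter]
    by_cases h1 : x ∈ A <;> by_cases h2 : x ∈ B <;> simp [h1, h2, hA']
  · simp only [Fin.mk_one]
    rw [← hBc]; congr 1; ext x; simp only [Finset.mem_filter]
    by_cases h1 : x ∈ A <;> by_cases h2 : x ∈ B
    · exact absurd h1 (hB' x h2).2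
    · simp [h1, h2]
    · simp [h1, h2, (hB' x h2).1]
    · simp [h1, h2]
  · simp only [Fin.reduceFinMk]
    rw [← hC]; congr 1; ext x; simp only [Finset.mem_filter, Finset.mem_sdiff]
    by_cases h1 : x ∈ A <;> by_cases h2 : x ∈ B <;> simp [h1, h2]

lemma sum_redc (col : ι → Bool) (f : ι → Fin 3) :
    ∑ j, redc col f j = (Finset.univ.filter (fun x => col x = true)).card := by
  rw [Finset.card_eq_sum_card_fiberwise (f := f) (t := Finset.univ) (fun _ _ => Finset.mem_coe.mpr (Finset.mem_univ _))]
  simp [redc, Finset.filter_filter]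

lemma exists_exact (col : ι → Bool) (N t : Fin 3 → ℕ) (htN : ∀ j, t j ≤ N j)
    (hN : Fintype.card ι = ∑ j, N j)
    (ht : (Finset.univ.filter (fun x => col x = true)).card = ∑ j, t j) :
    ∃ h0 : ι → Fin 3, ∀ j, (Finset.univ.filter (fun x => col x = true ∧ h0 x = j)).card = t j ∧
      (Finset.univ.filter (fun x => col x = false ∧ h0 x = j)).card = N j - t j := by
  obtain ⟨f, hf⟩ := exists_fib (Finset.univ.filter (fun x => col x = true)) t ht
  have hb : (Finset.univ.filter (fun x => col x = false)).card = ∑ j, (N j - t j) := by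
    have := Finset.card_filter_add_card_filter_not (s := (Finset.univ : Finset ι)) (fun x => col x = true)
    simp only [Bool.not_eq_true, Finset.card_univ] at this
    rw [Fin.sum_univ_three] at *
    have := htN 0; have := htN 1; have := htN 2
    omega
  obtain ⟨g, hg⟩ := exists_fib (Finset.univ.filter (fun x => col x = false)) _ hb
  refine ⟨fun x => if col x = true then f x else g x, fun j => ⟨?_, ?_⟩⟩
  · rw [← hf j, Finset.filter_filter]; congr 1; ext x
    simp only [Finset.mem_filter, Finset.mem_univ, true_and]
    cases col x <;> simp
  · rw [← hg j, Finset.filter_filter]; congr 1; ext x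
    simp only [Finset.mem_filter, Finset.mem_univ, true_and]
    cases col x <;> simp

lemma feas_of_counts (col : ι → Bool) (N t : Fin 3 → ℕ) (htN : ∀ j, t j ≤ N j) (f : ι → Fin 3)
    (h : ∀ j, (Finset.univ.filter (fun x => col x = true ∧ f x = j)).card = t j ∧
      (Finset.univ.filter (fun x => col x = false ∧ f x = j)).card = N j - t j) : Feas N f := by
  intro j
  have := Finset.card_filter_add_card_filter_not (s := (Finset.univ.filter (fun x => f x = j))) (fun x => col x = true)
  simp only [Finset.filter_filter, Bool.not_eq_true] at this
  simp only [and_comm (a := f _ = j)] at this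
  rw [(h j).1, (h j).2] at this
  have := htN j
  omega

/-- Farkas alternative: either there is an exact optimal assignment, or all the optimal ones lie in an
open half-plane. -/
lemma opt_alternative (p : ι → ℝ × ℝ) (col : ι → Bool) (N t : Fin 3 → ℕ) (htN : ∀ j, t j ≤ N j)
    (hN : Fintype.card ι = ∑ j, N j)
    (ht : (Finset.univ.filter (fun x => col x = true)).card = ∑ j, t j) (v : Fin 3 → ℝ × ℝ)
    (hno : ¬ ∃ f, IsOpt p N v f ∧ ∀ j, redc col f j = t j) :
    ∃ α β : ℝ, ∀ f, IsOpt p N v f →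
      0 < α * (((redc col f 0 : ℝ) - t 0) - ((redc col f 1 : ℝ) - t 1)) +
        β * (((redc col f 0 : ℝ) - t 0) + ((redc col f 1 : ℝ) - t 1)) := by
  classical
  obtain ⟨h0, hh0⟩ := exists_exact col N t htN hN ht
  have hfe0 := feas_of_counts col N t htN h0 hh0
  obtain ⟨fo, hfo⟩ := isOpt_exists p N v h0 hfe0
  let zf : (ι → Fin 3) → (ι → Fin 3 → ℝ) := fun f x j => if f x = j then 1 else 0
  let T : (ι → Fin 3 → ℝ) →ₗ[ℝ] ℝ × ℝ :=
    { toFun := fun z => (∑ x with col x = true, (z x 0 - z x 1), ∑ x with col x = true, (z x 0 + z x 1))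
      map_add' := by
        intro y z
        ext
        · simp only [Pi.add_apply, Prod.fst_add, ← Finset.sum_add_distrib]
          exact Finset.sum_congr rfl fun _ _ => by ring
        · simp only [Pi.add_apply, Prod.snd_add, ← Finset.sum_add_distrib]
          exact Finset.sum_congr rfl fun _ _ => by ring
      map_smul' := by
        intro c z
        ext
        · simp only [Pi.smul_apply, smul_eq_mul, Prod.smul_fst, RingHom.id_apply, Finset.mul_sum]
          exact Finset.sum_congr rfl fun _ _ => by ring
        · simp only [Pi.smul_apply, smul_eq_mul, Prod.smul_snd, RingHom.id_apply, Finset.mul_sum]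
          exact Finset.sum_congr rfl fun _ _ => by ring }
  have hred : ∀ f j, ∑ x with col x = true, zf f x j = (redc col f j : ℝ) := by
    intro f j
    simp [zf, redc, Finset.filter_filter]
  have hT : ∀ f, T (zf f) = ((redc col f 0 : ℝ) - redc col f 1, (redc col f 0 : ℝ) + redc col f 1) := by
    intro f
    simp only [T, LinearMap.coe_mk, AddHom.coe_mk, Finset.sum_sub_distrib, Finset.sum_add_distrib, hred]
  set S : Set (ι → Fin 3 → ℝ) := zf '' {f | IsOpt p N v f} with hS
  set τ : ℝ × ℝ := ((t 0 : ℝ) - t 1, (t 0 : ℝ) + t 1) with hτ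
  by_cases hmem : τ ∈ convexHull ℝ (T '' S)
  · exfalso
    rw [← LinearMap.image_convexHull] at hmem
    obtain ⟨z, hz, hzτ⟩ := hmem
    have hlin : ∀ (l : (ι → Fin 3 → ℝ) →ₗ[ℝ] ℝ) (c : ℝ), (∀ f, IsOpt p N v f → l (zf f) = c) → l z = c := by
      intro l c hl
      have : convexHull ℝ S ⊆ {y | l y = c} :=
        convexHull_min (by rintro _ ⟨f, hf, rfl⟩; exact hl f hf) (convex_hyperplane l.isLinear c)
      exact this hz
    let ev : ι → Fin 3 → (ι → Fin 3 → ℝ) →ₗ[ℝ] ℝ := fun x j =>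
      { toFun := fun y => y x j, map_add' := fun _ _ => rfl, map_smul' := fun _ _ => rfl }
    have hev : ∀ x j y, ev x j y = y x j := fun _ _ _ => rfl
    have hnn : ∀ x j, 0 ≤ z x j := by
      intro x j
      have : convexHull ℝ S ⊆ {y | 0 ≤ y x j} := by
        refine convexHull_min ?_ ?_
        · rintro _ ⟨f, hf, rfl⟩
          simp only [zf, Set.mem_ofPred_eq]
          split_ifs <;> norm_num
        · intro a ha b hb s t hs ht _
          simp only [Set.mem_ofPred_eq, Pi.add_apply, Pi.smul_apply, smul_eq_mul] at *
          positivity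
      exact this hz
    have hrow : ∀ x, ∑ j, z x j = 1 := by
      intro x
      have := hlin (∑ j, ev x j) 1 (by
        intro f hf
        simp [hev, zf])
      simpa [hev] using this
    have hcolN : ∀ j, ∑ x, z x j = N j := by
      intro j
      have := hlin (∑ x, ev x j) (N j) (by
        intro f hf
        simp [hev, zf, ← hf.1 j])
      simpa [hev] using this
    have hcost : ∑ x, ∑ j, z x j * dotp (v j) (p x) = tcost p v fo := by
      have := hlin (∑ x, ∑ j, dotp (v j) (p x) • ev x j) (tcost p v fo) (by
        intro f hf
        have e : tcost p v f = tcost p v fo := le_antisymm (hfo.2 f hf.1) (hf.2 fo hfo.1)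
        rw [← e]
        simp [hev, zf, tcost])
      rw [← this]
      simp [hev, mul_comm]
    have hτ1 : ∑ x with col x = true, (z x 0 - z x 1) = (t 0 : ℝ) - t 1 := congrArg Prod.fst hzτ
    have hτ2 : ∑ x with col x = true, (z x 0 + z x 1) = (t 0 : ℝ) + t 1 := congrArg Prod.snd hzτ
    rw [Finset.sum_sub_distrib] at hτ1
    rw [Finset.sum_add_distrib] at hτ2
    have hr0 : ∑ x with col x = true, z x 0 = (t 0 : ℝ) := by linarith
    have hr1 : ∑ x with col x = true, z x 1 = (t 1 : ℝ) := by linarith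
    have hr2 : ∑ x with col x = true, z x 2 = (t 2 : ℝ) := by
      have : ∑ x with col x = true, ∑ j, z x j = ((∑ j, t j : ℕ) : ℝ) := by
        rw [Finset.sum_congr rfl (fun x _ => hrow x), ← ht]; simp
      simp only [Fin.sum_univ_three, Finset.sum_add_distrib] at this
      push_cast at this
      linarith
    have hr : ∀ j, ∑ x with col x = true, z x j = (t j : ℝ) := by
      intro j; fin_cases j
      · exact hr0
      · exact hr1
      · exact hr2
    obtain ⟨f, hf, hfc⟩ := birkhoff_round col z h0 hnn hrow (by
      intro b j
      cases b
      · rw [(hh0 j).2, Nat.cast_sub (htN j), ← hcolN j, ← hr j,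
          ← Finset.sum_filter_add_sum_filter_not Finset.univ (fun x => col x = true)]
        simp
      · rw [(hh0 j).1, hr j]) (fun x j => dotp (v j) (p x))
    rw [hcost] at hfc
    have hff : Feas N f := feas_of_counts col N t htN f (fun j => ⟨(hf true j).trans (hh0 j).1,
      (hf false j).trans (hh0 j).2⟩)
    exact hno ⟨f, ⟨hff, fun f' hf' => (hfo.2 f' hf').trans hfc⟩, fun j => (hf true j).trans (hh0 j).1⟩
  · have hfin : (T '' S).Finite := (Set.toFinite _).image _ |>.image _
    obtain ⟨l, c, hl1, hl2⟩ := geometric_hahn_banach_point_closed (convex_convexHull ℝ (T '' S))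
      (hfin.isClosed_convexHull ℝ) hmem
    refine ⟨l (1, 0), l (0, 1), fun f hf => ?_⟩
    have h1 := hl2 (T (zf f)) (subset_convexHull ℝ _ ⟨_, ⟨f, hf, rfl⟩, rfl⟩)
    have hl : ∀ a b : ℝ, l (a, b) = l (1, 0) * a + l (0, 1) * b := by
      intro a b
      have : ((a, b) : ℝ × ℝ) = a • (1, 0) + b • (0, 1) := by ext <;> simp
      rw [this, map_add, map_smul, map_smul]; simp [mul_comm]
    rw [hT, hl] at h1
    rw [hτ, hl] at hl1
    nlinarith
end threecut

/-- the two-parameter family of sites -/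
noncomputable def Vf (q : ℝ × ℝ) : Fin 3 → ℝ × ℝ :=
  ![(0, 0), (1 - q.2, 0), (q.1, q.2 * (q.1 + 1) * (2 - q.1))]

lemma Vf_cont (j : Fin 3) : Continuous fun q => Vf q j := by
  fin_cases j
  · exact continuous_const
  · show Continuous fun q : ℝ × ℝ => ((1 - q.2, 0) : ℝ × ℝ)
    fun_prop
  · show Continuous fun q : ℝ × ℝ => ((q.1, q.2 * (q.1 + 1) * (2 - q.1)) : ℝ × ℝ)
    fun_prop

lemma fin3_third : ∀ j j' : Fin 3, ∃ i : Fin 3, i ≠ j ∧ i ≠ j' := by decide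

lemma fin3_all : ∀ i j j' l : Fin 3, j ≠ j' → i ≠ j → i ≠ j' → l ≠ i → l = j ∨ l = j' := by decide

section threecut2
variable {ι : Type*} [Fintype ι] [DecidableEq ι]

lemma tcost_cont (p : ι → ℝ × ℝ) (f : ι → Fin 3) : Continuous fun q => tcost p (Vf q) f := by
  unfold tcost dotp
  refine continuous_finsetSum _ fun x _ => ?_
  have := Vf_cont (f x)
  fun_prop

lemma isClosed_opt (p : ι → ℝ × ℝ) (N : Fin 3 → ℕ) (f : ι → Fin 3) :
    IsClosed {q | IsOpt p N (Vf q) f} := by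
  have : {q | IsOpt p N (Vf q) f} = {q | Feas N f} ∩
      ⋂ f', ⋂ (_ : Feas N f'), {q | tcost p (Vf q) f' ≤ tcost p (Vf q) f} := by
    ext q; simp only [IsOpt, Set.mem_ofPred_eq, Set.mem_inter_iff, Set.mem_iInter]
  rw [this]
  refine IsClosed.inter isClosed_const ?_
  exact isClosed_iInter fun f' => isClosed_iInter fun _ => isClosed_le (tcost_cont p f') (tcost_cont p f)

theorem three_cut (p : ι → ℝ × ℝ) (col : ι → Bool) (N t : Fin 3 → ℕ) (htN : ∀ j, t j ≤ N j)
    (hN : Fintype.card ι = ∑ j, N j)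
    (ht : (Finset.univ.filter (fun x => col x = true)).card = ∑ j, t j)
    (hdef : ∀ j, ∀ u : ℝ × ℝ, u ≠ 0 → ∀ S : Finset ι, S.card = N j →
      (∀ a ∈ S, ∀ b, b ∉ S → dotp u (p a) ≤ dotp u (p b)) →
      (S.filter (fun x => col x = true)).card < t j) :
    ∃ f : ι → Fin 3, Feas N f ∧ (∀ j, redc col f j = t j) ∧
      ∀ j j', j ≠ j' → ∃ u : ℝ × ℝ, u ≠ 0 ∧ ∀ a b, f a = j → f b = j' →
        dotp u (p a) ≤ dotp u (p b) := by
  classical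
  -- deficits on degenerate configurations
  have hdeg : ∀ (v : Fin 3 → ℝ × ℝ) (f : ι → Fin 3), IsOpt p N v f → ∀ (j : Fin 3) (u : ℝ × ℝ), u ≠ 0 →
      (∀ j', j' ≠ j → ∃ c : ℝ, 0 < c ∧ (v j').1 - (v j).1 = c * u.1 ∧ (v j').2 - (v j).2 = c * u.2) →
      redc col f j < t j := by
    intro v f hf j u hu hv
    have := hdef j u hu (Finset.univ.filter (fun x => f x = j)) (hf.1 j) (by
      intro a ha b hb
      exact opt_pre hf j u hv a b (by simpa using ha) (by simpa using hb))
    rw [Finset.filter_filter] at this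
    simpa [redc, and_comm] using this
  by_cases hex : ∃ q f, IsOpt p N (Vf q) f ∧ ∀ j, redc col f j = t j
  · obtain ⟨q, f, hf, hft⟩ := hex
    have hndeg : ¬ (Vf q 0 = Vf q 1 ∧ Vf q 0 = Vf q 2) := by
      rintro ⟨h1, h2⟩
      simp [Vf] at h1 h2
      obtain ⟨h2, h3⟩ := h2
      rw [← h2, show q.2 = 1 by linarith] at h3
      norm_num at h3
    have hne : ∀ j j' : Fin 3, j ≠ j' → Vf q j ≠ Vf q j' := by
      intro j j' hjj heq
      obtain ⟨i, hi1, hi2⟩ : ∃ i : Fin 3, i ≠ j ∧ i ≠ j' := fin3_third j j'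
      have hall : ∀ l : Fin 3, l ≠ i → l = j ∨ l = j' :=
        fun l hl => fin3_all i j j' l hjj hi1 hi2 hl
      have hu : Vf q j - Vf q i ≠ 0 := by
        intro h0
        have h0 : Vf q j = Vf q i := sub_eq_zero.mp h0
        have : ∀ l, Vf q l = Vf q i := by
          intro l
          by_cases hl : l = i
          · rw [hl]
          · rcases hall l hl with rfl | rfl
            · exact h0
            · rw [← heq, h0]
        exact hndeg ⟨by rw [this 0, this 1], by rw [this 0, this 2]⟩
      have := hdeg (Vf q) f hf i _ hu (by
        intro l hl
        refine ⟨1, one_pos, ?_⟩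
        rcases hall l hl with rfl | rfl
        · simp
        · rw [← heq]; simp)
      rw [hft i] at this
      exact lt_irrefl _ this
    refine ⟨f, hf.1, hft, fun j j' hjj => ⟨Vf q j' - Vf q j, sub_ne_zero.mpr (hne _ _ hjj.symm), ?_⟩⟩
    intro a b ha hb
    have := opt_swap hf a b
    rw [ha, hb] at this
    simp only [dotp, Prod.fst_sub, Prod.snd_sub] at *
    linarith
  exfalso
  obtain ⟨h0, hh0⟩ := exists_exact col N t htN hN ht
  have hfe0 := feas_of_counts col N t htN h0 hh0
  have halt : ∀ q, ∃ α β : ℝ, ∀ f, IsOpt p N (Vf q) f →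
      0 < α * (((redc col f 0 : ℝ) - t 0) - ((redc col f 1 : ℝ) - t 1)) +
        β * (((redc col f 0 : ℝ) - t 0) + ((redc col f 1 : ℝ) - t 1)) := fun q =>
    opt_alternative p col N t htN hN ht (Vf q) (fun ⟨f, h⟩ => hex ⟨q, f, h⟩)
  choose F hF using fun q => isOpt_exists p N (Vf q) h0 hfe0
  let U : ℝ × ℝ → Set (ℝ × ℝ) := fun q => {q' | ∀ f, IsOpt p N (Vf q') f → IsOpt p N (Vf q) f}
  have hUo : ∀ q, IsOpen (U q) := by
    intro q
    have : U q = (⋃ f ∈ {f : ι → Fin 3 | ¬ IsOpt p N (Vf q) f}, {q' | IsOpt p N (Vf q') f})ᶜ := by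
      ext q'
      simp only [U, Set.mem_ofPred_eq, Set.mem_compl_iff, Set.mem_iUnion, not_exists]
      constructor
      · intro h f h1 h2; exact h1 (h f h2)
      · intro h f h1; by_contra h2; exact h f h2 h1
    rw [this, isOpen_compl_iff]
    exact (Set.toFinite _).isClosed_biUnion fun f _ => isClosed_opt p N f
  obtain ⟨δ, hδ, hleb⟩ := lebesgue_number_lemma_of_metric (s := Set.Icc ((-1 : ℝ), (0 : ℝ)) (2, 1))
    isCompact_Icc hUo (fun q _ => Set.mem_iUnion.mpr ⟨q, fun f h => h⟩)
  obtain ⟨M, hM⟩ := exists_nat_gt (max (3 / δ) 4)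
  have hM1 : 3 / δ < M := lt_of_le_of_lt (le_max_left _ _) hM
  have hM4 : (4 : ℝ) < M := lt_of_le_of_lt (le_max_right _ _) hM
  have hM0 : (0 : ℝ) < M := by linarith
  have hMδ : 3 / (M : ℝ) < δ := by
    rw [div_lt_iff₀ hδ] at hM1
    rw [div_lt_iff₀ hM0]; linarith
  have hM3 : 3 / (M : ℝ) < 1 := by rw [div_lt_one hM0]; linarith
  have hM3' : 0 < 3 / (M : ℝ) := by positivity
  let Q : ℕ → ℕ → ℝ × ℝ := fun i j => (-1 + 3 / (M : ℝ) * i, 1 / (M : ℝ) * j)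
  let g : ℝ × ℝ → Fin 3 → ℝ := fun q j => (redc col (F q) j : ℝ) - t j
  have hg : ∀ q, g q 0 + g q 1 = - g q 2 := by
    intro q
    have h1 := sum_redc col (F q)
    rw [ht, Fin.sum_univ_three, Fin.sum_univ_three] at h1
    have h2 : (redc col (F q) 0 : ℝ) + redc col (F q) 1 + redc col (F q) 2 = t 0 + t 1 + t 2 := by
      exact_mod_cast h1
    simp only [g]; linarith
  have hgneg : ∀ q (j : Fin 3) (u : ℝ × ℝ), u ≠ 0 →
      (∀ j', j' ≠ j → ∃ c : ℝ, 0 < c ∧ (Vf q j').1 - (Vf q j).1 = c * u.1 ∧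
        (Vf q j').2 - (Vf q j).2 = c * u.2) → g q j < 0 := by
    intro q j u hu hv
    have := hdeg (Vf q) (F q) (hF q) j u hu hv
    have h' : (redc col (F q) j : ℝ) < t j := by exact_mod_cast this
    simp only [g]; linarith
  have u1 : ((1 : ℝ), (0 : ℝ)) ≠ 0 := by simp
  have u2 : ((-1 : ℝ), (0 : ℝ)) ≠ 0 := by simp
  have bl : ∀ s : ℝ, 0 ≤ s → s ≤ 1 → g (-1, s) 2 < 0 := by
    intro s hs0 hs1
    refine hgneg _ 2 (1, 0) u1 ?_
    intro j hj
    fin_cases j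
    · exact ⟨1, one_pos, by simp [Vf], by simp [Vf]⟩
    · exact ⟨2 - s, by linarith, by simp [Vf]; ring, by simp [Vf]⟩
    · exact absurd rfl hj
  have br : ∀ s : ℝ, 0 ≤ s → s ≤ 1 → g (2, s) 2 < 0 := by
    intro s hs0 hs1
    refine hgneg _ 2 (-1, 0) u2 ?_
    intro j hj
    fin_cases j
    · exact ⟨2, two_pos, by simp [Vf], by simp [Vf]⟩
    · exact ⟨1 + s, by linarith, by simp [Vf]; ring, by simp [Vf]⟩
    · exact absurd rfl hj
  have bt : ∀ x : ℝ, g (x, 1) 2 < 0 := by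
    intro x
    refine hgneg _ 2 (-x, -((x + 1) * (2 - x))) ?_ ?_
    · intro h
      simp only [Prod.mk_eq_zero, neg_eq_zero] at h
      rw [h.1] at h
      norm_num at h
    · intro j hj
      fin_cases j
      · exact ⟨1, one_pos, by simp [Vf], by simp [Vf]⟩
      · exact ⟨1, one_pos, by simp [Vf], by simp [Vf]⟩
      · exact absurd rfl hj
  have bb1 : ∀ x : ℝ, x < 1 → g (x, 0) 1 < 0 := by
    intro x hx
    refine hgneg _ 1 (-1, 0) u2 ?_
    intro j hj
    fin_cases j
    · exact ⟨1, one_pos, by simp [Vf], by simp [Vf]⟩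
    · exact absurd rfl hj
    · exact ⟨1 - x, by linarith, by simp [Vf], by simp [Vf]⟩
  have bb0 : ∀ x : ℝ, 0 < x → g (x, 0) 0 < 0 := by
    intro x hx
    refine hgneg _ 0 (1, 0) u1 ?_
    intro j hj
    fin_cases j
    · exact absurd rfl hj
    · exact ⟨1, one_pos, by simp [Vf], by simp [Vf]⟩
    · exact ⟨x, hx, by simp [Vf], by simp [Vf]⟩
  have Q0 : ∀ j, Q 0 j = (-1, 1 / (M : ℝ) * j) := by intro j; simp [Q]
  have QM : ∀ j, Q M j = (2, 1 / (M : ℝ) * j) := by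
    intro j; simp only [Q]; congr 1; field_simp; norm_num
  have QT : ∀ i, Q i M = (-1 + 3 / (M : ℝ) * i, 1) := by
    intro j; simp only [Q]; congr 1; field_simp
  have QB : ∀ i, Q i 0 = (-1 + 3 / (M : ℝ) * i, 0) := by intro i; simp [Q]
  have hs : ∀ j : ℕ, j ≤ M → 0 ≤ 1 / (M : ℝ) * j ∧ 1 / (M : ℝ) * j ≤ 1 := by
    intro j hj
    have : (j : ℝ) ≤ M := by exact_mod_cast hj
    refine ⟨by positivity, ?_⟩
    rw [div_mul_eq_mul_div, div_le_one hM0]; linarith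
  refine grid_lemma M (fun i j => (g (Q i j) 0 - g (Q i j) 1, g (Q i j) 0 + g (Q i j) 1))
    ?_ ?_ ?_ ?_ ?_ ?_ ?_
  · intro i hi j hj
    have hiM : (i : ℝ) ≤ M := by exact_mod_cast hi.le
    obtain ⟨q, hq⟩ := hleb (Q i j) (by
      have := hs j hj.le
      have h3 : 0 ≤ 3 / (M : ℝ) * i := by positivity
      have h4 : 3 / (M : ℝ) * i ≤ 3 := by
        rw [div_mul_eq_mul_div, div_le_iff₀ hM0]; linarith
      refine ⟨⟨?_, ?_⟩, ⟨?_, ?_⟩⟩ <;> simp only [Q] <;> linarith)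
    obtain ⟨α, β, hαβ⟩ := halt q
    refine ⟨α, β, fun a ha b hb => ?_⟩
    apply hαβ
    have hmem : Q (i + a) (j + b) ∈ Metric.ball (Q i j) δ := by
      have ha' : (a : ℝ) ≤ 1 := by exact_mod_cast ha
      have hb' : (b : ℝ) ≤ 1 := by exact_mod_cast hb
      have ha0 : (0 : ℝ) ≤ a := Nat.cast_nonneg _
      have hb0 : (0 : ℝ) ≤ b := Nat.cast_nonneg _
      have h13 : 1 / (M : ℝ) ≤ 3 / M := by gcongr; norm_num
      have h10 : 0 ≤ 1 / (M : ℝ) := by positivity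
      rw [Metric.mem_ball, Prod.dist_eq, max_lt_iff, Real.dist_eq, Real.dist_eq, abs_lt, abs_lt]
      simp only [Q]
      push_cast
      refine ⟨⟨?_, ?_⟩, ⟨?_, ?_⟩⟩ <;> nlinarith
    exact hq hmem _ (hF _)
  · intro j hj
    simp only [hg]
    rw [Q0]
    linarith [bl _ (hs j hj).1 (hs j hj).2]
  · intro j hj
    simp only [hg]
    rw [QM]
    linarith [br _ (hs j hj).1 (hs j hj).2]
  · intro i hi
    simp only [hg]
    rw [QT]
    linarith [bt (-1 + 3 / (M : ℝ) * i)]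
  · intro i hi
    simp only [QB]
    push_cast
    rcases lt_or_ge (-1 + 3 / (M : ℝ) * (i + 1)) 1 with h | h
    · have h1 := bb1 _ h
      have h2 := bb1 (-1 + 3 / (M : ℝ) * i) (by linarith)
      refine crossing_of_nonpos (α := 1) (β := -1) ?_ ?_ (by norm_num)
      · simp only; linarith
      · simp only; linarith
    · have h1 := bb0 (-1 + 3 / (M : ℝ) * (i + 1)) (by linarith)
      have h2 := bb0 (-1 + 3 / (M : ℝ) * i) (by linarith)
      refine crossing_of_nonpos (α := -1) (β := -1) ?_ ?_ (by norm_num)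
      · simp only; linarith
      · simp only; linarith
  · have h1 := bl 0 le_rfl zero_le_one
    have h2 := bb1 (-1) (by norm_num)
    have h3 := hg (-1, 0)
    simp only [QB]
    norm_num
    linarith
  · have h1 := br 0 le_rfl zero_le_one
    have h2 := bb0 2 (by norm_num)
    have h3 := hg (2, 0)
    simp only [QM]
    norm_num
    linarith
end threecut2

/-- `X` spans `n` disjoint `k`-islands each meeting `R` and its complement -/
def HasIsl (k n : ℕ) (R X : Finset PL) : Prop :=
  ∃ (ι : Type) (_ : Fintype ι), Fintype.card ι = n ∧ ∃ Y : ι → Finset PL,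
    (∀ i, Y i ⊆ X) ∧ (∀ i, (Y i).card = k) ∧ (∀ i, (Y i ∩ R).Nonempty) ∧ (∀ i, (Y i \ R).Nonempty) ∧
    ∀ i j, i ≠ j → Disjoint (convexHull ℝ (Y i : Set PL)) (convexHull ℝ (Y j : Set PL))

lemma HasIsl.combine {k : ℕ} {R X : Finset PL} {J : Type} [Fintype J] (a : J → ℕ)
    (A : J → Finset PL) (hA : ∀ j, A j ⊆ X)
    (hd : ∀ i j, i ≠ j → Disjoint (convexHull ℝ (A i : Set PL)) (convexHull ℝ (A j : Set PL)))
    (h : ∀ j, HasIsl k (a j) R (A j)) : HasIsl k (∑ j, a j) R X := by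
  choose I FI hI Y hY1 hY2 hY3 hY4 hY5 using h
  refine ⟨Σ j, I j, inferInstance, ?_, fun x => Y x.1 x.2, ?_, ?_, ?_, ?_, ?_⟩
  · rw [Fintype.card_sigma]; simp [hI]
  · intro x; exact (hY1 _ _).trans (hA _)
  · intro x; exact hY2 _ _
  · intro x; exact hY3 _ _
  · intro x; exact hY4 _ _
  · rintro ⟨i, x⟩ ⟨j, y⟩ hxy
    by_cases hij : i = j
    · subst hij
      exact hY5 i x y (fun h => hxy (by rw [h]))
    · exact (hd i j hij).mono (convexHull_mono (by exact_mod_cast hY1 i x))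
        (convexHull_mono (by exact_mod_cast hY1 j y))

lemma HasIsl.swap {k n : ℕ} {R X : Finset PL} (h : HasIsl k n (X \ R) X) : HasIsl k n R X := by
  obtain ⟨I, FI, hI, Y, h1, h2, h3, h4, h5⟩ := h
  refine ⟨I, FI, hI, Y, h1, h2, ?_, ?_, h5⟩
  · intro i
    obtain ⟨x, hx⟩ := h4 i
    have := h1 i
    simp only [Finset.mem_sdiff] at hx
    exact ⟨x, by simp only [Finset.mem_inter]; have := this hx.1; tauto⟩
  · intro i
    obtain ⟨x, hx⟩ := h3 i
    simp only [Finset.mem_sdiff, Finset.mem_inter] at hx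
    exact ⟨x, by simp only [Finset.mem_sdiff]; tauto⟩

lemma split_two (d a b r : ℕ) (hd : 1 ≤ d) (h1 : a + b ≤ r) (h2 : r ≤ d * (a + b)) :
    ∃ s t, a ≤ s ∧ s ≤ d * a ∧ b ≤ t ∧ t ≤ d * b ∧ s + t = r := by
  have ha : a ≤ d * a := Nat.le_mul_of_pos_left _ hd
  have hb : b ≤ d * b := Nat.le_mul_of_pos_left _ hd
  rw [mul_add] at h2
  refine ⟨min (d * a) (r - b), r - min (d * a) (r - b), ?_, ?_, ?_, ?_, ?_⟩ <;> omega

/-- all half-planes of size `a` have too few points of `R` -/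
def Lo (d n a : ℕ) (R X : Finset PL) : Prop :=
  ∀ u : ℝ × ℝ, u ≠ 0 → ∀ A, Pre X A u → A.card = (d + 1) * a →
    (A ∩ R).card < a ∨ (A ∩ R).card + d * (n - a) < (X ∩ R).card

/-- all half-planes of size `a` have too many points of `R` -/
def Hi (d n a : ℕ) (R X : Finset PL) : Prop :=
  ∀ u : ℝ × ℝ, u ≠ 0 → ∀ A, Pre X A u → A.card = (d + 1) * a →
    d * a < (A ∩ R).card ∨ (X ∩ R).card < (A ∩ R).card + (n - a)

lemma Pre.compl {X A : Finset PL} {u : ℝ × ℝ} (h : Pre X A u) : Pre X (X \ A) (-u) := by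
  refine ⟨Finset.sdiff_subset, fun a ha b hb => ?_⟩
  have hb' : b ∈ A := by
    simp only [Finset.mem_sdiff] at hb; tauto
  have := h.2 b hb' a ha
  simp only [lfun_apply, dotp, Prod.fst_neg, Prod.snd_neg] at *
  linarith

lemma inter_compl_card {X A R : Finset PL} (h : A ⊆ X) :
    ((X \ A) ∩ R).card + (A ∩ R).card = (X ∩ R).card := by
  rw [← Finset.card_union_of_disjoint]
  · congr 1
    ext x
    have := @h x
    simp only [Finset.mem_union, Finset.mem_inter, Finset.mem_sdiff]; tauto
  · rw [Finset.disjoint_left]; intro x; simp only [Finset.mem_inter, Finset.mem_sdiff]; tauto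

lemma compl_inter_card {X A R : Finset PL} (h : A ⊆ X) :
    (A ∩ (X \ R)).card + (A ∩ R).card = A.card := by
  rw [← Finset.card_union_of_disjoint]
  · congr 1
    ext x
    have := @h x
    simp only [Finset.mem_union, Finset.mem_inter, Finset.mem_sdiff]; tauto
  · rw [Finset.disjoint_left]; intro x; simp only [Finset.mem_inter, Finset.mem_sdiff]; tauto

lemma hi_to_lo {d n a : ℕ} {R X : Finset PL} (ha : a ≤ n) (hX : X.card = (d + 1) * n)
    (h : Hi d n a R X) : Lo d n (n - a) R X := by
  intro u hu A hA hc
  have h1 := h (-u) (neg_ne_zero.mpr hu) _ hA.compl (by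
    rw [Finset.card_sdiff_of_subset hA.1, hX, hc, ← Nat.mul_sub]; congr 1; omega)
  have h2 := inter_compl_card (R := R) hA.1
  rw [Nat.sub_sub_self ha]
  rcases h1 with h1 | h1
  · right; omega
  · left; omega

lemma lo_to_hi {d n a : ℕ} {R X : Finset PL} (ha : a ≤ n) (hX : X.card = (d + 1) * n)
    (h : Lo d n a R X) : Hi d n (n - a) R X := by
  intro u hu A hA hc
  have h1 := h (-u) (neg_ne_zero.mpr hu) _ hA.compl (by
    rw [Finset.card_sdiff_of_subset hA.1, hX, hc, ← Nat.mul_sub]; congr 1; omega)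
  have h2 := inter_compl_card (R := R) hA.1
  rw [Nat.sub_sub_self ha]
  rcases h1 with h1 | h1
  · right; omega
  · left; omega

lemma hi_swap {d n a : ℕ} {R X : Finset PL} (ha : a ≤ n) (hX : X.card = (d + 1) * n)
    (h : Hi d n a R X) : Lo d n a (X \ R) X := by
  intro u hu A hA hc
  have h1 := h u hu A hA hc
  have h2 := compl_inter_card (R := R) hA.1
  have h3 := compl_inter_card (R := R) (subset_refl X)
  obtain ⟨b, rfl⟩ := Nat.exists_eq_add_of_le ha
  rw [Nat.add_sub_cancel_left] at *
  simp only [add_mul, mul_add, one_mul] at *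
  rcases h1 with h1 | h1
  · left; omega
  · right; omega

lemma lo_hi_false {d n a : ℕ} {R X : Finset PL} (hd : 1 ≤ d) (ha : a ≤ n) (hX : X.card = (d + 1) * n)
    (hr1 : n ≤ (X ∩ R).card) (hr2 : (X ∩ R).card ≤ d * n)
    (h : Lo d n a R X) (h' : Hi d n a R X) : False := by
  obtain ⟨A, hA, hc⟩ := exists_pre X (1, 0) ((d + 1) * a) (by rw [hX]; gcongr)
  have hu : ((1 : ℝ), (0 : ℝ)) ≠ 0 := by simp
  have h1 := h _ hu A hA hc
  have h2 := h' _ hu A hA hc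
  obtain ⟨b, rfl⟩ := Nat.exists_eq_add_of_le ha
  rw [Nat.add_sub_cancel_left] at *
  have h3 : a ≤ d * a := Nat.le_mul_of_pos_left _ hd
  have h4 : b ≤ d * b := Nat.le_mul_of_pos_left _ hd
  simp only [add_mul, mul_add, one_mul] at *
  omega

lemma lo_or_hi {d n a : ℕ} {R X : Finset PL} (hg : GenPos 2 X) (hd : 1 ≤ d) (ha1 : 1 ≤ a) (ha : a ≤ n)
    (hr1 : n ≤ (X ∩ R).card) (hr2 : (X ∩ R).card ≤ d * n)
    (hno : ¬ ∃ u : ℝ × ℝ, u ≠ 0 ∧ ∃ A, Pre X A u ∧ A.card = (d + 1) * a ∧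
      a ≤ (A ∩ R).card ∧ (X ∩ R).card ≤ (A ∩ R).card + d * (n - a) ∧
      (A ∩ R).card ≤ d * a ∧ (A ∩ R).card + (n - a) ≤ (X ∩ R).card) :
    Lo d n a R X ∨ Hi d n a R X := by
  by_contra hcon
  simp only [Lo, Hi] at hcon
  push Not at hcon
  obtain ⟨⟨u, hu, A, hA, hc, h1, h2⟩, ⟨u', hu', A', hA', hc', h1', h2'⟩⟩ := hcon
  apply hno
  obtain ⟨b, rfl⟩ := Nat.exists_eq_add_of_le ha
  rw [Nat.add_sub_cancel_left] at *
  have h3 : a ≤ d * a := Nat.le_mul_of_pos_left _ hd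
  have h4 : b ≤ d * b := Nat.le_mul_of_pos_left _ hd
  by_cases hA1 : (A ∩ R).card ≤ d * a ∧ (A ∩ R).card + b ≤ (X ∩ R).card
  · exact ⟨u, hu, A, hA, hc, h1, h2, hA1⟩
  by_cases hA2 : a ≤ (A' ∩ R).card ∧ (X ∩ R).card ≤ (A' ∩ R).card + d * b
  · exact ⟨u', hu', A', hA', hc', hA2.1, hA2.2, h1', h2'⟩
  rw [mul_add] at hr2
  obtain ⟨v, hv, B, hB, hBc, hBr⟩ := pre_ivt (R := R) hg ((d + 1) * a)
    (max a ((X ∩ R).card - d * b) - 1) hu' hu hA' hA hc' hc (by omega) (by omega)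
  exact ⟨v, hv, B, hB, hBc, by omega, by omega, by omega, by omega⟩

lemma lo_step (d n : ℕ) (hd : 1 ≤ d) (R X : Finset PL) (hg : GenPos 2 X) (hX : X.card = (d + 1) * n)
    (hr1 : n ≤ (X ∩ R).card) (hr2 : (X ∩ R).card ≤ d * n)
    (ih : ∀ a, 1 ≤ a → a < n → ∀ A ⊆ X, A.card = (d + 1) * a → a ≤ (A ∩ R).card →
      (A ∩ R).card ≤ d * a → HasIsl (d + 1) a R A)
    (a : Fin 3 → ℕ) (ha : ∀ i, 1 ≤ a i) (hs : ∑ i, a i = n) (hlo : ∀ i, Lo d n (a i) R X) :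
    HasIsl (d + 1) n R X := by
  classical
  have hs' := hs
  rw [Fin.sum_univ_three] at hs'
  obtain ⟨t0, t', h1, h2, h3, h4, h5⟩ := split_two d (a 0) (a 1 + a 2) (X ∩ R).card hd
    (by omega) (by rw [← add_assoc, hs']; exact hr2)
  obtain ⟨t1, t2, k1, k2, k3, k4, k5⟩ := split_two d (a 1) (a 2) t' hd h3 h4
  let t : Fin 3 → ℕ := ![t0, t1, t2]
  have hta : ∀ i, a i ≤ t i := by intro i; fin_cases i <;> assumption
  have htd : ∀ i, t i ≤ d * a i := by intro i; fin_cases i <;> assumption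
  have hts : ∑ i, t i = (X ∩ R).card := by
    rw [Fin.sum_univ_three]; simp only [t]; show t0 + t1 + t2 = _; omega
  have hlt : ∀ i, t i + d * (n - a i) ≥ (X ∩ R).card := by
    intro i
    rw [← hts, ← hs, ← Finset.add_sum_erase _ t (Finset.mem_univ i),
      ← Finset.add_sum_erase _ a (Finset.mem_univ i), Nat.add_sub_cancel_left, Finset.mul_sum]
    gcongr
    exact htd _
  have hmapR : ∀ S : Finset X, ((S.filter (fun x : X => decide ((x : PL) ∈ R) = true)).card) =
      ((S.map (Function.Embedding.subtype _)) ∩ R).card := by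
    intro S
    rw [← Finset.card_map (Function.Embedding.subtype _)]
    congr 1
    ext x
    simp only [Finset.mem_map, Finset.mem_filter, Finset.mem_inter, decide_eq_true_eq,
      Function.Embedding.coe_subtype]
    constructor
    · rintro ⟨y, ⟨h, h'⟩, rfl⟩; exact ⟨⟨y, h, rfl⟩, h'⟩
    · rintro ⟨⟨y, h, rfl⟩, h'⟩; exact ⟨y, ⟨h, h'⟩, rfl⟩
  have hmapX : ∀ S : Finset X, S.map (Function.Embedding.subtype _) ⊆ X := by
    intro S x hx
    simp only [Finset.mem_map, Function.Embedding.coe_subtype] at hx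
    obtain ⟨y, _, rfl⟩ := hx
    exact y.2
  obtain ⟨f, hf1, hf2, hf3⟩ := three_cut (ι := X) (fun x => prj x) (fun x => decide ((x : PL) ∈ R))
    (fun i => (d + 1) * a i) t
    (fun i => (htd i).trans (by gcongr; omega))
    (by rw [Fintype.card_coe, hX, ← Finset.mul_sum, hs])
    (by
      rw [hts, hmapR]; congr 1
      ext x; simp)
    (by
      intro i u hu S hS hsep
      rw [hmapR]
      have := hlo i u hu (S.map (Function.Embedding.subtype _)) ⟨hmapX S, by
        intro x hx y hy
        simp only [Finset.mem_sdiff, Finset.mem_map, Function.Embedding.coe_subtype] at hx hy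
        obtain ⟨x, hx, rfl⟩ := hx
        exact hsep x hx ⟨y, hy.1⟩ (fun h => hy.2 ⟨_, h, rfl⟩)⟩ (by rw [Finset.card_map, hS])
      have h6 := hta i
      have h7 := hlt i
      omega)
  let A : Fin 3 → Finset PL := fun i => (Finset.univ.filter (fun x => f x = i)).map (Function.Embedding.subtype _)
  have hmemA : ∀ i x, x ∈ A i ↔ ∃ h : x ∈ X, f ⟨x, h⟩ = i := by
    intro i x; simp [A]
  rw [← hs]
  refine HasIsl.combine a A (fun i => hmapX _) ?_ ?_
  · intro i j hij
    obtain ⟨u, hu, hsep⟩ := hf3 i j hij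
    refine sep_disjoint hg hu (hmapX _) (hmapX _) ?_ ?_
    · rw [Finset.disjoint_left]
      intro x hx hy
      obtain ⟨h, h'⟩ := (hmemA i x).1 hx
      obtain ⟨h2, h2'⟩ := (hmemA j x).1 hy
      exact hij (h'.symm.trans h2')
    · intro x hx y hy
      obtain ⟨h, h'⟩ := (hmemA i x).1 hx
      obtain ⟨h2, h2'⟩ := (hmemA j y).1 hy
      exact hsep _ _ h' h2'
  · intro i
    have hc : (A i ∩ R).card = t i := by
      rw [← hf2 i, ← hmapR, Finset.filter_filter, redc]
      congr 1; ext x; simp [and_comm]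
    refine ih (a i) (ha i) ?_ (A i) (hmapX _) ?_ ?_ ?_
    · have := ha 0; have := ha 1; have := ha 2
      fin_cases i <;> simp <;> omega
    · rw [Finset.card_map]; exact hf1 i
    · rw [hc]; exact hta i
    · rw [hc]; exact htd i

lemma lo_main (d n : ℕ) (hd : 1 ≤ d) (R X : Finset PL) (hg : GenPos 2 X) (hX : X.card = (d + 1) * n)
    (hr1 : n ≤ (X ∩ R).card) (hr2 : (X ∩ R).card ≤ d * n)
    (ih : ∀ a, 1 ≤ a → a < n → ∀ A ⊆ X, A.card = (d + 1) * a → a ≤ (A ∩ R).card →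
      (A ∩ R).card ≤ d * a → HasIsl (d + 1) a R A) (hn : 2 ≤ n)
    (hdich : ∀ a, 1 ≤ a → a < n → Lo d n a R X ∨ Hi d n a R X)
    (h1 : Lo d n 1 R X) : HasIsl (d + 1) n R X := by
  classical
  have hex : ∃ a, 1 ≤ a ∧ Hi d n a R X := ⟨n - 1, by omega, lo_to_hi (by omega) hX h1⟩
  have hmin := fun b => Nat.find_min (m := b) hex
  have hle := Nat.find_min' hex (⟨by omega, lo_to_hi (by omega) hX h1⟩ : 1 ≤ n - 1 ∧ _)
  obtain ⟨ha1, ha⟩ := Nat.find_spec hex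
  set a := Nat.find hex
  have ha2 : a ≠ 1 := by
    intro h
    rw [h] at ha
    exact lo_hi_false hd (by omega) hX hr1 hr2 h1 ha
  have hlo : Lo d n (a - 1) R X := by
    rcases hdich (a - 1) (by omega) (by omega) with h | h
    · exact h
    · exact absurd ⟨by omega, h⟩ (hmin (a - 1) (by omega))
  refine lo_step d n hd R X hg hX hr1 hr2 ih ![1, a - 1, n - a] ?_ ?_ ?_
  · intro i; fin_cases i <;> simp <;> omega
  · rw [Fin.sum_univ_three]; simp; omega
  · intro i; fin_cases i
    · exact h1
    · exact hlo
    · exact hi_to_lo (by omega) hX ha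

theorem two_colour (d : ℕ) (hd : 1 ≤ d) (n : ℕ) : 1 ≤ n → ∀ R X : Finset PL, GenPos 2 X →
    X.card = (d + 1) * n → n ≤ (X ∩ R).card → (X ∩ R).card ≤ d * n → HasIsl (d + 1) n R X := by
  induction n using Nat.strong_induction_on with
  | _ n IH =>
  intro hn R X hg hX hr1 hr2
  rcases Nat.lt_or_ge n 2 with hn2 | hn2
  · obtain rfl : n = 1 := by omega
    refine ⟨Unit, inferInstance, rfl, fun _ => X, fun _ => subset_rfl, fun _ => by rw [hX, mul_one], fun _ => ?_,
      fun _ => ?_, fun i j h => absurd rfl h⟩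
    · show (X ∩ R).Nonempty
      rw [← Finset.card_pos]; omega
    · show (X \ R).Nonempty
      have := compl_inter_card (R := R) (subset_refl X)
      rw [Finset.inter_eq_right.mpr Finset.sdiff_subset] at this
      rw [← Finset.card_pos]; omega
  by_cases hex : ∃ a, 1 ≤ a ∧ a < n ∧ ∃ u : ℝ × ℝ, u ≠ 0 ∧ ∃ A, Pre X A u ∧ A.card = (d + 1) * a ∧
      a ≤ (A ∩ R).card ∧ (X ∩ R).card ≤ (A ∩ R).card + d * (n - a) ∧
      (A ∩ R).card ≤ d * a ∧ (A ∩ R).card + (n - a) ≤ (X ∩ R).card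
  · obtain ⟨a, ha1, han, u, hu, A, hA, hc, g1, g2, g3, g4⟩ := hex
    have h2 := inter_compl_card (R := R) hA.1
    have hI1 := IH a han ha1 R A (hg.mono hA.1) hc g1 g3
    have hI2 := IH (n - a) (by omega) (by omega) R (X \ A) (hg.mono Finset.sdiff_subset)
      (by rw [Finset.card_sdiff_of_subset hA.1, hX, hc, ← Nat.mul_sub]) (by omega) (by omega)
    have hdis := sep_disjoint hg hu hA.1 (Finset.sdiff_subset : X \ A ⊆ X) Finset.disjoint_sdiff hA.2
    have := HasIsl.combine (k := d + 1) (R := R) (X := X) (J := Fin 2) ![a, n - a] ![A, X \ A]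
      (by intro j; fin_cases j; exacts [hA.1, Finset.sdiff_subset])
      (by
        intro i j hij
        fin_cases i <;> fin_cases j
        · exact absurd rfl hij
        · exact hdis
        · exact hdis.symm
        · exact absurd rfl hij)
      (by intro j; fin_cases j; exacts [hI1, hI2])
    rw [Fin.sum_univ_two] at this
    simpa [show a + (n - a) = n by omega] using this
  have hdich : ∀ a, 1 ≤ a → a < n → Lo d n a R X ∨ Hi d n a R X := fun a ha1 han =>
    lo_or_hi hg hd ha1 han.le hr1 hr2 (fun h => hex ⟨a, ha1, han, h⟩)
  rcases hdich 1 le_rfl hn2 with h | h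
  · exact lo_main d n hd R X hg hX hr1 hr2
      (fun a ha1 han A hA hc g1 g2 => IH a han ha1 R A (hg.mono hA) hc g1 g2) hn2 hdich h
  · have h3 := compl_inter_card (R := R) (subset_refl X)
    have hXX : X \ (X \ R) = X ∩ R := by ext x; simp
    refine HasIsl.swap (lo_main d n hd (X \ R) X hg hX ?_ ?_
      (fun a ha1 han A hA hc g1 g2 => IH a han ha1 _ A (hg.mono hA) hc g1 g2) hn2 ?_
      (hi_swap (by omega) hX h))
    · simp only [add_mul, one_mul] at *; omega
    · simp only [add_mul, one_mul] at *; omega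
    · intro a ha1 han
      have hXc : X.card = (d + 1) * n := hX
      rcases hdich (n - a) (by omega) (by omega) with h | h
      · left
        have := lo_to_hi (by omega) hX h
        rw [Nat.sub_sub_self han.le] at this
        exact hi_swap han.le hX this
      · right
        have := lo_to_hi (by omega) hX (hi_swap (by omega) hX h)
        rwa [Nat.sub_sub_self han.le] at this

lemma not_collinear_of_genpos {X : Finset PL} (h : GenPos 2 X) {a b c : PL} (ha : a ∈ X) (hb : b ∈ X)
    (hc : c ∈ X) (hab : a ≠ b) (hac : a ≠ c) (hbc : b ≠ c) : ¬ Collinear ℝ {a, b, c} := by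
  rw [← affineIndependent_iff_not_collinear_set]
  have hind := h {a, b, c} (by intro x; simp; rintro (rfl | rfl | rfl) <;> assumption)
    (Finset.card_le_three)
  let e : Fin 3 → ({a, b, c} : Finset PL) := ![⟨a, by simp⟩, ⟨b, by simp⟩, ⟨c, by simp⟩]
  have he : Function.Injective e := by
    intro i j hij
    fin_cases i <;> fin_cases j <;> simp [e, hab, hac, hbc, hab.symm, hac.symm, hbc.symm] at hij ⊢
  have := hind.comp_embedding ⟨e, he⟩
  have heq : ![a, b, c] = (fun p : ({a, b, c} : Finset PL) => (p : PL)) ∘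
      (⟨e, he⟩ : Fin 3 ↪ ({a, b, c} : Finset PL)) := by
    funext i
    fin_cases i <;> rfl
  rw [heq]
  exact this

lemma cross_strict {X : Finset PL} (h : GenPos 2 X) {a b c e o : PL} (ha : a ∈ X) (hb : b ∈ X)
    (hc : c ∈ X) (he : e ∈ X) (hab : a ≠ b) (hac : a ≠ c) (hae : a ≠ e) (hbe : b ≠ e) (hce : c ≠ e)
    (h1 : Wbtw ℝ a o b) (h2 : Wbtw ℝ c o e) : dist a e < dist a o + dist o e := by
  refine lt_of_le_of_ne (dist_triangle _ _ _) fun heq => ?_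
  have h3 : Wbtw ℝ a o e := dist_add_dist_eq_iff.mp heq.symm
  by_cases hao : a = o
  · subst hao
    have := h2.collinear
    exact not_collinear_of_genpos h hc ha he hac.symm hce hae this
  · have hb' : b ∈ line[ℝ, a, o] := by
      exact h1.right_mem_affineSpan_of_left_ne hao
    have he' : e ∈ line[ℝ, a, o] := h3.right_mem_affineSpan_of_left_ne hao
    refine not_collinear_of_genpos h ha hb he hab hae hbe ?_
    exact collinear_triple_of_mem_affineSpan_pair (left_mem_affineSpan_pair ℝ a o) hb' he'

lemma sum_two_lt {n : ℕ} (D D' : Fin n → ℝ) (i j : Fin n) (hij : i ≠ j)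
    (h : ∀ l, l ≠ i → l ≠ j → D' l = D l) (hlt : D' i + D' j < D i + D j) :
    ∑ l, D' l < ∑ l, D l := by
  have key : ∀ E : Fin n → ℝ, ∑ l, E l = E i + (E j + ∑ l ∈ (Finset.univ.erase i).erase j, E l) := by
    intro E
    rw [Finset.add_sum_erase _ E (by simp [hij.symm]), Finset.add_sum_erase _ E (by simp)]
  rw [key D, key D']
  have : ∑ l ∈ (Finset.univ.erase i).erase j, D' l = ∑ l ∈ (Finset.univ.erase i).erase j, D l := by
    refine Finset.sum_congr rfl fun l hl => ?_
    simp only [Finset.mem_erase, Finset.mem_univ, and_true] at hl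
    exact h l hl.2 hl.1
  linarith

theorem pairs_case {κ : Type*} (col : PL → κ) (n : ℕ) (X : Finset PL) (hg : GenPos 2 X)
    (g0 : Fin n × Bool → X) (hinj0 : Function.Injective g0)
    (hc0 : ∀ i, col (g0 (i, false)) ≠ col (g0 (i, true))) :
    ∃ Y : Fin n → Finset PL, (∀ i, Y i ⊆ X) ∧ (∀ i, (Y i).card = 2) ∧
      (∀ i, ∃ p ∈ Y i, ∃ q ∈ Y i, col p ≠ col q) ∧
      ∀ i j, i ≠ j → Disjoint (convexHull ℝ (Y i : Set PL)) (convexHull ℝ (Y j : Set PL)) := by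
  classical
  let S : Set (Fin n × Bool → X) := {g | Function.Injective g ∧
    ∀ i, col (g (i, false)) ≠ col (g (i, true))}
  let D : (Fin n × Bool → X) → Fin n → ℝ := fun g l => dist (g (l, false) : PL) (g (l, true))
  obtain ⟨g, ⟨hinj, hcol⟩, hmin⟩ := Set.exists_min_image S (fun g => ∑ l, D g l) (Set.toFinite S)
    ⟨g0, hinj0, hc0⟩
  have hne : ∀ q q', q ≠ q' → (g q : PL) ≠ g q' := fun q q' hq h => hq (hinj (Subtype.ext h))
  refine ⟨fun i => {(g (i, false) : PL), (g (i, true) : PL)}, ?_, ?_, ?_, ?_⟩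
  · intro i x hx
    simp only [Finset.mem_insert, Finset.mem_singleton] at hx
    rcases hx with rfl | rfl <;> exact Subtype.property _
  · intro i
    exact Finset.card_pair (hne _ _ (by simp))
  · intro i
    exact ⟨_, by simp, _, by simp, hcol i⟩
  intro i j hij
  rw [Set.disjoint_left]
  intro o ho1 ho2
  rw [Finset.coe_pair, convexHull_pair, mem_segment_iff_wbtw] at ho1 ho2
  have ma := (g (i, false)).2
  have mb := (g (i, true)).2
  have mc := (g (j, false)).2
  have me := (g (j, true)).2
  have nab := hne (i, false) (i, true) (by simp)
  have nac := hne (i, false) (j, false) (by simp [hij])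
  have nae := hne (i, false) (j, true) (by simp)
  have nbc := hne (i, true) (j, false) (by simp)
  have nbe := hne (i, true) (j, true) (by simp [hij])
  have nce := hne (j, false) (j, true) (by simp)
  have e1 := ho1.dist_add_dist
  have e2 := ho2.dist_add_dist
  have hsw : ∀ q : Fin n × Bool, ∀ g', g' = g ∘ Equiv.swap (i, true) q → Function.Injective g' := by
    rintro q g' rfl
    exact hinj.comp (Equiv.injective _)
  by_cases hcase : col (g (i, false)) ≠ col (g (j, true)) ∧ col (g (j, false)) ≠ col (g (i, true))
  · have v1 : ∀ l, Equiv.swap (i, true) (j, true) (l, false) = (l, false) := fun l =>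
      Equiv.swap_apply_of_ne_of_ne (by simp) (by simp)
    have v2 : ∀ l, l ≠ i → l ≠ j → Equiv.swap (i, true) (j, true) (l, true) = (l, true) := fun l h h' =>
      Equiv.swap_apply_of_ne_of_ne (by simp [h]) (by simp [h'])
    have hmem : (g ∘ Equiv.swap (i, true) (j, true)) ∈ S := by
      refine ⟨hsw _ _ rfl, fun l => ?_⟩
      simp only [Function.comp, v1]
      by_cases hl : l = i
      · subst hl; rw [Equiv.swap_apply_left]; exact hcase.1
      by_cases hl' : l = j
      · subst hl'; rw [Equiv.swap_apply_right]; exact hcase.2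
      rw [v2 l hl hl']; exact hcol l
    refine absurd (hmin _ hmem) (not_le.mpr (sum_two_lt _ _ i j hij ?_ ?_))
    · intro l hl hl'
      simp only [D, Function.comp, v1, v2 l hl hl']
    · simp only [D, Function.comp, v1, Equiv.swap_apply_left, Equiv.swap_apply_right]
      have s1 := cross_strict hg ma mb mc me nab nac nae nbe nce ho1 ho2
      have s2 := dist_triangle (g (j, false) : PL) o (g (i, true))
      linarith
  · have hcase2 : col (g (i, false)) ≠ col (g (j, false)) ∧ col (g (i, true)) ≠ col (g (j, true)) := by
      have q1 := hcol i
      have q2 := hcol j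
      grind
    have v1 : ∀ l, l ≠ j → Equiv.swap (i, true) (j, false) (l, false) = (l, false) := fun l h =>
      Equiv.swap_apply_of_ne_of_ne (by simp) (by simp [h])
    have v2 : ∀ l, l ≠ i → Equiv.swap (i, true) (j, false) (l, true) = (l, true) := fun l h =>
      Equiv.swap_apply_of_ne_of_ne (by simp [h]) (by simp)
    have hmem : (g ∘ Equiv.swap (i, true) (j, false)) ∈ S := by
      refine ⟨hsw _ _ rfl, fun l => ?_⟩
      simp only [Function.comp]
      by_cases hl : l = i
      · subst hl; rw [Equiv.swap_apply_left, v1 _ hij]; exact hcase2.1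
      by_cases hl' : l = j
      · subst hl'; rw [Equiv.swap_apply_right, v2 _ hl]; exact hcase2.2
      rw [v2 l hl, v1 l hl']; exact hcol l
    refine absurd (hmin _ hmem) (not_le.mpr (sum_two_lt _ _ i j hij ?_ ?_))
    · intro l hl hl'
      simp only [D, Function.comp, v1 l hl', v2 l hl]
    · simp only [D, Function.comp, v1 i hij, v2 j hij.symm, Equiv.swap_apply_left, Equiv.swap_apply_right]
      have s1 := cross_strict hg ma mb me mc nab nae nac nbc nce.symm ho1 ho2.symm
      have s2 := dist_triangle (g (i, true) : PL) o (g (j, true))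
      rw [dist_comm (g (i, true) : PL) o] at s2
      rw [dist_comm o (g (j, false) : PL)] at s1
      linarith

lemma colorful_iff {m : ℕ} (C : Fin m → Finset PL) (col : PL → Fin m) (X : Finset PL)
    (hcol : ∀ x ∈ X, ∀ c, x ∈ C c ↔ col x = c) (A : Finset PL) (hA : A ⊆ X) :
    2 ≤ (Finset.univ.filter (fun c : Fin m => (A ∩ C c).Nonempty)).card ↔
      ∃ p ∈ A, ∃ q ∈ A, col p ≠ col q := by
  show 1 < _ ↔ _
  rw [Finset.one_lt_card]
  simp only [Finset.mem_filter, Finset.mem_univ, true_and]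
  constructor
  · rintro ⟨c, ⟨p, hp⟩, c', ⟨q, hq⟩, hne⟩
    simp only [Finset.mem_inter] at hp hq
    rw [hcol _ (hA hp.1)] at hp
    rw [hcol _ (hA hq.1)] at hq
    exact ⟨p, hp.1, q, hq.1, by rw [hp.2, hq.2]; exact hne⟩
  · rintro ⟨p, hp, q, hq, hne⟩
    refine ⟨col p, ⟨p, ?_⟩, col q, ⟨q, ?_⟩, hne⟩
    · rw [Finset.mem_inter, hcol _ (hA hp)]; exact ⟨hp, rfl⟩
    · rw [Finset.mem_inter, hcol _ (hA hq)]; exact ⟨hq, rfl⟩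

lemma choose_classes {m n d : ℕ} (hn : 1 ≤ n) (hd : 2 ≤ d) (X : Finset PL) (col : PL → Fin m)
    (hX : X.card = (d + 1) * n)
    (hc : ∀ c, n ≤ (X.filter (fun x => col x ≠ c)).card) :
    ∃ T : Finset (Fin m), n ≤ (X.filter (fun x => col x ∈ T)).card ∧
      (X.filter (fun x => col x ∈ T)).card ≤ d * n := by
  classical
  obtain ⟨T, hT, hmin⟩ := Set.exists_min_image
    {T : Finset (Fin m) | n ≤ (X.filter (fun x => col x ∈ T)).card} Finset.card (Set.toFinite _)
    ⟨Finset.univ, by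
      simp only [Set.mem_ofPred_eq, Finset.mem_univ, Finset.filter_true]
      rw [hX]; exact Nat.le_mul_of_pos_left _ (by omega)⟩
  simp only [Set.mem_ofPred_eq] at hT hmin
  refine ⟨T, hT, ?_⟩
  have hTne : T.Nonempty := by
    rw [Finset.nonempty_iff_ne_empty]
    rintro rfl
    simp at hT; omega
  obtain ⟨c, hcT⟩ := hTne
  have hsplit := Finset.card_filter_add_card_filter_not (s := X) (fun x => col x ∈ T)
  by_cases h1 : T.card = 1
  · rw [Finset.card_eq_one] at h1
    obtain ⟨c', rfl⟩ := h1
    have := hc c'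
    simp only [Finset.mem_singleton] at *
    simp only [add_mul, one_mul] at *
    simp only [ne_eq] at this
    omega
  · have hpos : 0 < T.card := Finset.card_pos.mpr ⟨c, hcT⟩
    have e1 : (X.filter (fun x => col x ∈ ({c} : Finset (Fin m)))).card < n := by
      by_contra h
      have := hmin {c} (by omega)
      rw [Finset.card_singleton] at this
      omega
    have e2 : (X.filter (fun x => col x ∈ T.erase c)).card < n := by
      by_contra h
      have := hmin (T.erase c) (by omega)
      rw [Finset.card_erase_of_mem hcT] at this
      omega
    have e3 : X.filter (fun x => col x ∈ T) ⊆ X.filter (fun x => col x ∈ ({c} : Finset (Fin m))) ∪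
        X.filter (fun x => col x ∈ T.erase c) := by
      intro x hx
      simp only [Finset.mem_filter, Finset.mem_union, Finset.mem_singleton, Finset.mem_erase] at *
      tauto
    have e4 := (Finset.card_le_card e3).trans (Finset.card_union_le _ _)
    have : 2 * n ≤ d * n := Nat.mul_le_mul_right _ hd
    omega

lemma finish {m n k : ℕ} (X : Finset PL) (C : Fin m → Finset PL) (col : PL → Fin m)
    (hcol : ∀ x ∈ X, ∀ c, x ∈ C c ↔ col x = c) (hX : X.card = k * n) (Y : Fin n → Finset PL)
    (h1 : ∀ i, Y i ⊆ X) (h2 : ∀ i, (Y i).card = k) (h3 : ∀ i, ∃ p ∈ Y i, ∃ q ∈ Y i, col p ≠ col q)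
    (h4 : ∀ i j, i ≠ j → Disjoint (convexHull ℝ (Y i : Set PL)) (convexHull ℝ (Y j : Set PL))) :
    ∃ Y : Fin n → Finset PL,
      (∀ i, Y i ⊆ X) ∧
      (∀ i, (Y i).card = k) ∧
      (∀ i, 2 ≤ (Finset.univ.filter (fun c : Fin m => ((Y i) ∩ C c).Nonempty)).card) ∧
      (∀ i, (X : Set PL) ∩ convexHull ℝ (Y i : Set PL) = (Y i : Set PL)) ∧
      (∀ i j, i ≠ j →
        Disjoint (convexHull ℝ (Y i : Set PL)) (convexHull ℝ (Y j : Set PL))) := by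
  refine ⟨Y, h1, h2, fun i => (colorful_iff C col X hcol _ (h1 i)).2 (h3 i), ?_, h4⟩
  have hun : Finset.univ.biUnion Y = X := by
    refine Finset.eq_of_subset_of_card_le (Finset.biUnion_subset.mpr fun i _ => h1 i) ?_
    rw [Finset.card_biUnion]
    · simp [h2, hX, mul_comm]
    · intro i _ j _ hij
      show Disjoint (Y i) (Y j)
      rw [Finset.disjoint_left]
      intro x hx hy
      exact Set.disjoint_left.mp (h4 i j hij) (subset_convexHull ℝ _ (by exact_mod_cast hx))
        (subset_convexHull ℝ _ (by exact_mod_cast hy))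
  intro i
  apply Set.Subset.antisymm
  · rintro x ⟨hx, hxi⟩
    have hx' : x ∈ Finset.univ.biUnion Y := by rw [hun]; exact_mod_cast hx
    simp only [Finset.mem_biUnion, Finset.mem_univ, true_and] at hx'
    obtain ⟨j, hj⟩ := hx'
    by_cases hij : i = j
    · subst hij; exact_mod_cast hj
    · exact absurd (subset_convexHull ℝ _ (by exact_mod_cast hj)) (Set.disjoint_left.mp (h4 i j hij) hxi)
  · intro x hx
    exact ⟨by exact_mod_cast h1 i (by exact_mod_cast hx), subset_convexHull ℝ _ hx⟩

theorem colorful_islands_plane_general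
    (k m n : ℕ) (hk : 2 ≤ k) (hm : 2 ≤ m) (hn : 1 ≤ n)
    (X : Finset (EuclideanSpace ℝ (Fin 2)))
    (C : Fin m → Finset (EuclideanSpace ℝ (Fin 2)))
    (hdisj : ∀ c c' : Fin m, c ≠ c' → Disjoint (C c) (C c'))
    (hunion : Finset.univ.biUnion C = X)
    (hcard : X.card = k * n)
    (hgp : GenPos 2 X)
    -- X admits a partition into n pairwise disjoint 2-colorful k-tuples
    (hpart : ∃ P : Fin n → Finset (EuclideanSpace ℝ (Fin 2)),
        (∀ i j, i ≠ j → Disjoint (P i) (P j)) ∧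
        Finset.univ.biUnion P = X ∧
        (∀ i, (P i).card = k) ∧
        (∀ i, 2 ≤ (Finset.univ.filter (fun c : Fin m => ((P i) ∩ C c).Nonempty)).card)) :
    ∃ Y : Fin n → Finset (EuclideanSpace ℝ (Fin 2)),
      (∀ i, Y i ⊆ X) ∧
      (∀ i, (Y i).card = k) ∧
      (∀ i, 2 ≤ (Finset.univ.filter (fun c : Fin m => ((Y i) ∩ C c).Nonempty)).card) ∧
      (∀ i, (X : Set (EuclideanSpace ℝ (Fin 2))) ∩ convexHull ℝ ((Y i : Set (EuclideanSpace ℝ (Fin 2))))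
          = (Y i : Set (EuclideanSpace ℝ (Fin 2)))) ∧
      (∀ i j, i ≠ j →
        Disjoint (convexHull ℝ ((Y i : Set (EuclideanSpace ℝ (Fin 2)))))
          (convexHull ℝ ((Y j : Set (EuclideanSpace ℝ (Fin 2)))))) := by
  classical
  have hm0 : 0 < m := by omega
  have hXc : ∀ x ∈ X, ∃ c, x ∈ C c := by
    intro x hx; rw [← hunion] at hx; simpa using hx
  let col : PL → Fin m := fun x => if h : ∃ c, x ∈ C c then h.choose else ⟨0, hm0⟩
  have hcol : ∀ x ∈ X, ∀ c, x ∈ C c ↔ col x = c := by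
    intro x hx c
    have hex := hXc x hx
    have hx2 : x ∈ C (col x) := by
      simp only [col, dif_pos hex]; exact hex.choose_spec
    constructor
    · intro h
      by_contra hne
      exact Finset.disjoint_left.mp (hdisj _ _ hne) hx2 h
    · intro h; rw [← h]; exact hx2
  obtain ⟨P, hP1, hP2, hP3, hP4⟩ := hpart
  have hPX : ∀ i, P i ⊆ X := by
    intro i; rw [← hP2]; exact Finset.subset_biUnion_of_mem P (Finset.mem_univ i)
  have hPc := fun i => (colorful_iff C col X hcol _ (hPX i)).1 (hP4 i)
  have hPinj : ∀ i j x, x ∈ P i → x ∈ P j → i = j := by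
    intro i j x hx hy
    by_contra hne
    exact Finset.disjoint_left.mp (hP1 i j hne) hx hy
  choose a ha b hb hab using hPc
  rcases Nat.lt_or_ge k 3 with hk3 | hk3
  · obtain rfl : k = 2 := by omega
    obtain ⟨Y, h1, h2, h3, h4⟩ := pairs_case col n X hgp
      (fun q => if q.2 = true then ⟨b q.1, hPX _ (hb _)⟩ else ⟨a q.1, hPX _ (ha _)⟩)
      (by
        rintro ⟨i, s⟩ ⟨j, t⟩ hij
        cases s <;> cases t <;> simp at hij
        · have := hPinj i j _ (ha i) (hij ▸ ha j)
          rw [this]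
        · have := hPinj i j _ (ha i) (hij ▸ hb j)
          subst this
          exact absurd (congrArg col hij) (hab i)
        · have := hPinj i j _ (hb i) (hij ▸ ha j)
          subst this
          exact absurd (congrArg col hij).symm (hab i)
        · have := hPinj i j _ (hb i) (hij ▸ hb j)
          rw [this])
      (by intro i; simpa using hab i)
    exact finish X C col hcol hcard Y h1 h2 h3 h4
  · obtain ⟨d, rfl⟩ : ∃ d, k = d + 1 := ⟨k - 1, by omega⟩
    obtain ⟨T, hT1, hT2⟩ := choose_classes hn (show 2 ≤ d by omega) X col hcard (by
      intro c
      let w : Fin n → PL := fun i => if col (a i) = c then b i else a i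
      have hw : ∀ i, w i ∈ P i ∧ col (w i) ≠ c := by
        intro i
        simp only [w]
        split_ifs with h
        · exact ⟨hb i, fun h' => hab i (h.trans h'.symm)⟩
        · exact ⟨ha i, h⟩
      have := Finset.card_le_card_of_injOn (s := (Finset.univ : Finset (Fin n)))
        (t := X.filter (fun x => col x ≠ c)) w
        (by
          intro i _
          simp only [Finset.coe_filter, Set.mem_ofPred_eq]
          exact ⟨hPX _ (hw i).1, (hw i).2⟩)
        (by
          intro i _ j _ hij
          exact hPinj i j _ (hw i).1 (hij ▸ (hw j).1))
      simpa using this)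
    have hXR : X ∩ X.filter (fun x => col x ∈ T) = X.filter (fun x => col x ∈ T) :=
      Finset.inter_eq_right.mpr (Finset.filter_subset _ _)
    obtain ⟨I, FI, hI, Y, h1, h2, h3, h4, h5⟩ := two_colour d (by omega) n hn
      (X.filter (fun x => col x ∈ T)) X hgp hcard (by rw [hXR]; exact hT1) (by rw [hXR]; exact hT2)
    let e : Fin n ≃ I := (Fintype.equivFinOfCardEq hI).symm
    refine finish X C col hcol hcard (fun i => Y (e i)) (fun i => h1 _) (fun i => h2 _) ?_
      (fun i j hij => h5 _ _ (fun h => hij (e.injective h)))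
    intro i
    obtain ⟨p, hp⟩ := h3 (e i)
    obtain ⟨q, hq⟩ := h4 (e i)
    simp only [Finset.mem_inter, Finset.mem_sdiff, Finset.mem_filter] at hp hq
    refine ⟨p, hp.1, q, hq.1, fun h => hq.2 ⟨h1 _ hq.1, ?_⟩⟩
    rw [← h]; exact hp.2.2
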